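/- Let r ∈ (0,∞), κ ∈ [4,∞), and suppose the coefficients depend only on x_1: A^{αβ}(t,x) = Ā^{αβ}(x_1). Suppose u : ℝ^{1+d} → ℝ^m is smooth and satisfies −u_t + D_α(A^{αβ}D_βu) = 0 weakly in Q_{κr}, and set U = Σ_{β=1}^d Ā^{1β}(x_1) D_βu. Then (|U − (U)_{Q_r}|)_{Q_r} ≤ N κ^{-1/2} ((|Du|²)_{Q_{κr}})^{1/2} and (|D_{x'}u − (D_{x'}u)_{Q_r}|)_{Q_r} ≤ N κ^{-1/2} ((|Du|²)_{Q_{κr}})^{1/2}, where N = N(d,m,δ). -/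

import Mathlib

open MeasureTheory Metric Set Function
open scoped ENNReal NNReal RealInnerProductSpace BigOperators

noncomputable section

/-- `ℝ^d` with the Euclidean norm. -/
abbrev Ed (d : ℕ) : Type := EuclideanSpace ℝ (Fin d)
/-- `ℝ^m` with the Euclidean norm. -/
abbrev Em (m : ℕ) : Type := EuclideanSpace ℝ (Fin m)
/-- `m × m` real matrices, viewed as linear operators on `ℝ^m`. -/
abbrev CLM (m : ℕ) : Type := Em m →L[ℝ] Em m

/-- Spatial partial derivative `D_α u` of a function on `ℝ^{1+d}`. -/
def pd {d : ℕ} {F : Type*} [NormedAddCommGroup F] [NormedSpace ℝ F]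
    (α : Fin d) (u : ℝ × Ed d → F) (q : ℝ × Ed d) : F :=
  fderiv ℝ u q (0, EuclideanSpace.single α 1)

/-- Time derivative `∂_t u` of a function on `ℝ^{1+d}`. -/
def pt {d : ℕ} {F : Type*} [NormedAddCommGroup F] [NormedSpace ℝ F]
    (u : ℝ × Ed d → F) (q : ℝ × Ed d) : F :=
  fderiv ℝ u q (1, 0)

/-- `|Du|²`, the squared Euclidean norm of the spatial gradient. -/
def gradSq {d m : ℕ} (u : ℝ × Ed d → Em m) (q : ℝ × Ed d) : ℝ :=
  ∑ α, ‖pd α u q‖ ^ 2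

/-- The parabolic cylinder `Q_r(t,x) = (t - r², t) × B_r(x)`. -/
def Qc {d : ℕ} (r t : ℝ) (x : Ed d) : Set (ℝ × Ed d) :=
  Ioo (t - r ^ 2) t ×ˢ ball x r

/-- `Q_r = Q_r(0,0)`. -/
def Qc0 {d : ℕ} (r : ℝ) : Set (ℝ × Ed d) := Qc r 0 0

/-- Boundedness by `δ⁻¹` together with the ellipticity condition with constant `δ`
for a family of `m × m` matrices. -/
def EllipticPt (δ : ℝ) {d m : ℕ} (a : Fin d → Fin d → CLM m) : Prop :=
  (∀ α β, ‖a α β‖ ≤ δ⁻¹) ∧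
  ∀ ξ : Fin d → Em m, δ * ∑ α, ‖ξ α‖ ^ 2 ≤ ∑ α, ∑ β, ⟪ξ α, a α β (ξ β)⟫

/-- Measurable, bounded, uniformly elliptic coefficients on `ℝ^{1+d}`. -/
def Coeffs (δ : ℝ) {d m : ℕ} (A : Fin d → Fin d → ℝ × Ed d → CLM m) : Prop :=
  (∀ α β, Measurable (A α β)) ∧ ∀ q, EllipticPt δ (fun α β => A α β q)

/-- The class `𝒜`: measurable, bounded, uniformly elliptic coefficients depending on
one real variable. -/
def CoeffsOne (δ : ℝ) {d m : ℕ} (Ab : Fin d → Fin d → ℝ → CLM m) : Prop :=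
  (∀ α β, Measurable (Ab α β)) ∧ ∀ s, EllipticPt δ (fun α β => Ab α β s)

/-- The class `Ψ` of `C^{1,1}` diffeomorphisms of `ℝ^d`: `ψ` and its inverse `φ`
are `C^1` with Lipschitz first derivatives, and `|Dψ| + |D²ψ| ≤ δ⁻¹`,
`|Dφ| + |D²φ| ≤ δ⁻¹` (where the second derivative is measured by the Lipschitz
constant of the first derivative). -/
def IsPsi (δ : ℝ) {d : ℕ} (ψ φ : Ed d → Ed d) : Prop :=
  Function.LeftInverse φ ψ ∧ Function.RightInverse φ ψ ∧
  ContDiff ℝ 1 ψ ∧ ContDiff ℝ 1 φ ∧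
  ∃ K K' : ℝ≥0, LipschitzWith K (fderiv ℝ ψ) ∧ LipschitzWith K' (fderiv ℝ φ) ∧
    (∀ x, ‖fderiv ℝ ψ x‖ + (K : ℝ) ≤ δ⁻¹) ∧ ∀ y, ‖fderiv ℝ φ y‖ + (K' : ℝ) ≤ δ⁻¹

/-- `U = Σ_β Ā^{1β}(x₁) D_β u`. -/
def Ubar {d m : ℕ} [NeZero d] (Ab : Fin d → Fin d → ℝ → CLM m)
    (u : ℝ × Ed d → Em m) (q : ℝ × Ed d) : Em m :=
  ∑ β, Ab 0 β (q.2 0) (pd β u q)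

set_option linter.unusedSectionVars false

/-! ### Basic calculus on `ℝ × Ed d` -/

instance instHaarX (d : ℕ) : (volume : Measure (ℝ × Ed d)).IsAddHaarMeasure := by
  rw [Measure.volume_eq_prod]; infer_instance

/-- Directional derivative. -/
def dd {d : ℕ} {F : Type*} [NormedAddCommGroup F] [NormedSpace ℝ F]
    (e : ℝ × Ed d) (u : ℝ × Ed d → F) (q : ℝ × Ed d) : F := fderiv ℝ u q e

section basic
variable {d : ℕ} {F : Type*} [NormedAddCommGroup F] [NormedSpace ℝ F]

theorem pd_eq_dd (α : Fin d) (u : ℝ × Ed d → F) :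
    pd α u = dd (0, EuclideanSpace.single α 1) u := rfl

theorem pt_eq_dd (u : ℝ × Ed d → F) : pt u = dd (1, 0) u := rfl

theorem dd_smooth (e : ℝ × Ed d) {u : ℝ × Ed d → F} (hu : ContDiff ℝ (⊤ : ℕ∞) u) :
    ContDiff ℝ (⊤ : ℕ∞) (dd e u) := by
  have h := hu.fderiv_right (m := ((⊤ : ℕ∞) : WithTop ℕ∞)) (by simp)
  exact h.clm_apply contDiff_const

theorem pd_smooth (α : Fin d) {u : ℝ × Ed d → F} (hu : ContDiff ℝ (⊤ : ℕ∞) u) :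
    ContDiff ℝ (⊤ : ℕ∞) (pd α u) := dd_smooth _ hu

theorem dd_line (e : ℝ × Ed d) {u : ℝ × Ed d → F} (hu : ContDiff ℝ (⊤ : ℕ∞) u) (q : ℝ × Ed d) :
    HasLineDerivAt ℝ u (dd e u q) q e :=
  ((hu.differentiable (by simp)) q).hasFDerivAt.hasLineDerivAt e

theorem dd_comm (e f : ℝ × Ed d) {u : ℝ × Ed d → F} (hu : ContDiff ℝ (⊤ : ℕ∞) u) :
    dd e (dd f u) = dd f (dd e u) := by
  funext q
  have h := hu.fderiv_right (m := ((⊤ : ℕ∞) : WithTop ℕ∞)) (by simp)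
  have hd : DifferentiableAt ℝ (fderiv ℝ u) q := (h.differentiable (by simp)) q
  have hs : IsSymmSndFDerivAt ℝ u q := hu.contDiffAt.isSymmSndFDerivAt (by
    simp only [minSmoothness_of_isRCLikeNormedField]; exact WithTop.coe_le_coe.2 (le_top : (2:ℕ∞) ≤ ⊤))
  have key : ∀ a b : ℝ × Ed d, dd a (dd b u) q = fderiv ℝ (fderiv ℝ u) q a b := by
    intro a b
    have h1 : HasFDerivAt (fun p => fderiv ℝ u p b)
        ((ContinuousLinearMap.apply ℝ F b).comp (fderiv ℝ (fderiv ℝ u) q)) q :=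
      (ContinuousLinearMap.apply ℝ F b).hasFDerivAt.comp q hd.hasFDerivAt
    change fderiv ℝ (fun p => fderiv ℝ u p b) q a = _
    rw [h1.fderiv]; rfl
  rw [key, key]; exact hs e f

theorem dd_compact (e : ℝ × Ed d) {u : ℝ × Ed d → F} (hu : HasCompactSupport u) :
    HasCompactSupport (dd e u) := hu.fderiv_apply ℝ e

theorem dd_tsupport (e : ℝ × Ed d) (u : ℝ × Ed d → F) :
    tsupport (dd e u) ⊆ tsupport u := by
  refine (closure_mono ?_).trans (tsupport_fderiv_subset ℝ)
  intro x hx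
  simp only [mem_support] at hx ⊢
  intro h; apply hx; simp [dd, h]

/-- integral of a line derivative vanishes -/
theorem int_line_zero {P P' : ℝ × Ed d → ℝ} {e : ℝ × Ed d}
    (hP : Integrable P) (hP' : Integrable P')
    (h : ∀ q, HasLineDerivAt ℝ P (P' q) q e) : ∫ q, P' q = 0 := by
  have := integral_bilinear_hasLineDerivAt_right_eq_neg_left_of_integrable
    (μ := (volume : Measure (ℝ × Ed d))) (f := P) (f' := P') (g := fun _ => (1:ℝ))
    (g' := fun _ => (0:ℝ)) (v := e) (B := ContinuousLinearMap.mul ℝ ℝ)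
    (by simpa using hP') (by simp) (by simpa using hP) (fun x _ => h x)
    (fun x _ => by simpa [HasLineDerivAt] using hasDerivAt_const (0:ℝ) (1:ℝ))
  simp at this
  linarith

theorem dd_mul (e : ℝ × Ed d) {f : ℝ × Ed d → ℝ} {u : ℝ × Ed d → F} (hf : ContDiff ℝ (⊤ : ℕ∞) f)
    (hu : ContDiff ℝ (⊤ : ℕ∞) u) (q : ℝ × Ed d) :
    dd e (fun p => f p • u p) q = f q • dd e u q + dd e f q • u q := by
  have h1 := ((hf.differentiable (by simp)) q).hasFDerivAt
  have h2 := ((hu.differentiable (by simp)) q).hasFDerivAt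
  unfold dd
  rw [(h1.fun_smul h2).fderiv]
  simp

theorem dd_pow (e : ℝ × Ed d) {f : ℝ × Ed d → ℝ} (hf : ContDiff ℝ (⊤ : ℕ∞) f)
    (n : ℕ) (q : ℝ × Ed d) :
    dd e (fun p => f p ^ (n+1)) q = ((n:ℝ) + 1) * f q ^ n * dd e f q := by
  have h1 := ((hf.differentiable (by simp)) q).hasFDerivAt
  unfold dd
  rw [(h1.pow (n+1)).fderiv]
  simp
end basic

/-! ### The bilinear form and weak solutions -/

/-- The bilinear form of the system. -/
def Bf {d m : ℕ} [NeZero d] (A : Fin d → Fin d → ℝ → CLM m) (v w : ℝ × Ed d → Em m)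
    (q : ℝ × Ed d) : ℝ :=
  ∑ α, ∑ β, ⟪A α β (q.2 0) (pd β v q), pd α w q⟫

/-- Weak solutions (with time derivative on the solution). -/
def WS {d m : ℕ} [NeZero d] (A : Fin d → Fin d → ℝ → CLM m) (Ω : Set (ℝ × Ed d))
    (v : ℝ × Ed d → Em m) : Prop :=
  ∀ φ : ℝ × Ed d → Em m, ContDiff ℝ (⊤ : ℕ∞) φ → HasCompactSupport φ → tsupport φ ⊆ Ω →
    ∫ q, (⟪pt v q, φ q⟫ + Bf A v φ q) = 0

section bform
variable {d m : ℕ}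

theorem int_cs {E : Type*} [NormedAddCommGroup E] {K : Set (ℝ × Ed d)} (hK : IsCompact K)
    {F : ℝ × Ed d → E} {H : ℝ × Ed d → ℝ}
    (hF : AEStronglyMeasurable F) (hH : Continuous H) (hb : ∀ q, ‖F q‖ ≤ H q)
    (h0 : ∀ q, q ∉ K → F q = 0) : Integrable F := by
  have hs : support F ⊆ K := fun q hq => by
    by_contra h; exact hq (h0 q h)
  rw [← integrableOn_iff_integrable_of_support_subset hs]
  exact (hH.continuousOn.integrableOn_compact hK).mono' hF.restrict
    (Filter.Eventually.of_forall hb)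

theorem int_cont {E : Type*} [NormedAddCommGroup E] {K : Set (ℝ × Ed d)} (hK : IsCompact K)
    {F : ℝ × Ed d → E} (hF : Continuous F)
    (h0 : ∀ q, q ∉ K → F q = 0) : Integrable F :=
  int_cs hK hF.aestronglyMeasurable hF.norm (fun _ => le_rfl) h0

theorem dd_off {F : Type*} [NormedAddCommGroup F] [NormedSpace ℝ F]
    {u : ℝ × Ed d → F} {q : ℝ × Ed d} (e : ℝ × Ed d) (hq : q ∉ tsupport u) : dd e u q = 0 :=
  image_eq_zero_of_notMem_tsupport (fun h => hq (dd_tsupport e u h))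

theorem pd_off {F : Type*} [NormedAddCommGroup F] [NormedSpace ℝ F]
    {u : ℝ × Ed d → F} {q : ℝ × Ed d} (α : Fin d) (hq : q ∉ tsupport u) : pd α u q = 0 :=
  dd_off _ hq

theorem gradSq_nonneg (v : ℝ × Ed d → Em m) (q : ℝ × Ed d) : 0 ≤ gradSq v q :=
  Finset.sum_nonneg fun _ _ => by positivity

theorem pd_sq_le (α : Fin d) (v : ℝ × Ed d → Em m) (q : ℝ × Ed d) :
    ‖pd α v q‖ ^ 2 ≤ gradSq v q :=
  Finset.single_le_sum (f := fun α => ‖pd α v q‖ ^ 2) (fun _ _ => by positivity)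
    (Finset.mem_univ α)

theorem pd_le (α : Fin d) (v : ℝ × Ed d → Em m) (q : ℝ × Ed d) :
    ‖pd α v q‖ ≤ √(gradSq v q) := Real.le_sqrt_of_sq_le (pd_sq_le α v q)

theorem gradSq_cont {v : ℝ × Ed d → Em m} (hv : ContDiff ℝ (⊤ : ℕ∞) v) :
    Continuous (gradSq v) := by
  unfold gradSq
  exact continuous_finsetSum _ fun α _ => ((pd_smooth α hv).continuous.norm.pow 2)

variable [NeZero d] {δ : ℝ} {A : Fin d → Fin d → ℝ → CLM m}

theorem A_meas (hA : CoeffsOne δ A) (α β : Fin d) {g : ℝ × Ed d → Em m} (hg : Continuous g) :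
    Measurable (fun q : ℝ × Ed d => A α β (q.2 0) (g q)) := by
  have h1 : Measurable (fun q : ℝ × Ed d => A α β (q.2 0)) :=
    (hA.1 α β).comp (by fun_prop : Continuous fun q : ℝ × Ed d => q.2 0).measurable
  exact ContinuousLinearMap.measurable_apply₂.comp (h1.prodMk hg.measurable)

theorem A_bound (hA : CoeffsOne δ A) (α β : Fin d) (s : ℝ) (x : Em m) :
    ‖A α β s x‖ ≤ δ⁻¹ * ‖x‖ :=
  ((A α β s).le_opNorm x).trans (by gcongr; exact (hA.2 s).1 α β)

theorem Bf_meas (hA : CoeffsOne δ A) {v w : ℝ × Ed d → Em m} (hv : ContDiff ℝ (⊤ : ℕ∞) v)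
    (hw : ContDiff ℝ (⊤ : ℕ∞) w) : Measurable (Bf A v w) := by
  unfold Bf
  refine Finset.measurable_sum _ fun α _ => Finset.measurable_sum _ fun β _ => ?_
  exact (A_meas hA α β (pd_smooth β hv).continuous).inner (pd_smooth α hw).continuous.measurable

theorem Bf_bound (hδ : 0 < δ) (hA : CoeffsOne δ A) (v w : ℝ × Ed d → Em m) (q : ℝ × Ed d) :
    |Bf A v w q| ≤ (d:ℝ) ^ 2 * δ⁻¹ * (√(gradSq v q) * √(gradSq w q)) := by
  unfold Bf
  calc _ ≤ ∑ α : Fin d, ∑ β : Fin d, δ⁻¹ * (√(gradSq v q) * √(gradSq w q)) := by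
        refine (Finset.abs_sum_le_sum_abs _ _).trans (Finset.sum_le_sum fun α _ => ?_)
        refine (Finset.abs_sum_le_sum_abs _ _).trans (Finset.sum_le_sum fun β _ => ?_)
        calc _ ≤ ‖A α β (q.2 0) (pd β v q)‖ * ‖pd α w q‖ := abs_real_inner_le_norm _ _
          _ ≤ (δ⁻¹ * ‖pd β v q‖) * ‖pd α w q‖ := by gcongr; exact A_bound hA _ _ _ _
          _ ≤ (δ⁻¹ * √(gradSq v q)) * √(gradSq w q) := by
            gcongr <;> apply pd_le
          _ = _ := by ring
    _ = _ := by simp; ring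

theorem Bf_ell (hA : CoeffsOne δ A) (v : ℝ × Ed d → Em m) (q : ℝ × Ed d) :
    δ * gradSq v q ≤ Bf A v v q := by
  refine ((hA.2 (q.2 0)).2 (fun α => pd α v q)).trans (le_of_eq ?_)
  unfold Bf
  refine Finset.sum_congr rfl fun α _ => Finset.sum_congr rfl fun β _ => ?_
  rw [real_inner_comm]

theorem Bf_int (hδ : 0 < δ) (hA : CoeffsOne δ A) {v w : ℝ × Ed d → Em m}
    (hv : ContDiff ℝ (⊤ : ℕ∞) v)
    (hw : ContDiff ℝ (⊤ : ℕ∞) w) (hc : HasCompactSupport w) : Integrable (Bf A v w) := by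
  refine int_cs hc.isCompact (Bf_meas hA hv hw).aestronglyMeasurable
    (H := fun q => (d:ℝ) ^ 2 * δ⁻¹ * (√(gradSq v q) * √(gradSq w q)))
    ?_ (fun q => by rw [Real.norm_eq_abs]; exact Bf_bound hδ hA v w q) ?_
  · have := gradSq_cont hv
    have := gradSq_cont hw
    fun_prop
  · intro q hq
    simp [Bf, pd_off _ hq]

theorem inner_int {v w : ℝ × Ed d → Em m} (hv : ContDiff ℝ (⊤ : ℕ∞) v)
    (hw : ContDiff ℝ (⊤ : ℕ∞) w) (hc : HasCompactSupport w) :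
    Integrable (fun q => ⟪v q, w q⟫) := by
  refine int_cont hc.isCompact (hv.continuous.inner hw.continuous) ?_
  intro q hq
  simp [image_eq_zero_of_notMem_tsupport hq]

theorem inner_line {v w : ℝ × Ed d → Em m} (hv : ContDiff ℝ (⊤ : ℕ∞) v)
    (hw : ContDiff ℝ (⊤ : ℕ∞) w) (e q : ℝ × Ed d) :
    HasLineDerivAt ℝ (fun q => ⟪v q, w q⟫) (⟪v q, dd e w q⟫ + ⟪dd e v q, w q⟫) q e := by
  have h1 := dd_line e hv q
  have h2 := dd_line e hw q
  unfold HasLineDerivAt at *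
  simpa using h1.inner ℝ h2

theorem A_line (α β : Fin d) {v : ℝ × Ed d → Em m} (hv : ContDiff ℝ (⊤ : ℕ∞) v)
    (e q : ℝ × Ed d) (he : e.2 0 = 0) :
    HasLineDerivAt ℝ (fun q : ℝ × Ed d => A α β (q.2 0) (v q)) (A α β (q.2 0) (dd e v q)) q e := by
  have h1 := dd_line e hv q
  unfold HasLineDerivAt at *
  have h2 := (A α β (q.2 0)).hasFDerivAt.comp_hasDerivAt (0:ℝ) h1
  refine h2.congr_of_eventuallyEq (Filter.Eventually.of_forall fun t => ?_)
  simp [he]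

theorem Bf_line {v w : ℝ × Ed d → Em m} (hv : ContDiff ℝ (⊤ : ℕ∞) v)
    (hw : ContDiff ℝ (⊤ : ℕ∞) w) (e q : ℝ × Ed d) (he : e.2 0 = 0) :
    HasLineDerivAt ℝ (Bf A v w) (Bf A v (dd e w) q + Bf A (dd e v) w q) q e := by
  unfold HasLineDerivAt Bf
  simp_rw [← Finset.sum_add_distrib]
  refine HasDerivAt.fun_sum fun α _ => HasDerivAt.fun_sum fun β _ => ?_
  have h1 := A_line (A := A) α β (pd_smooth β hv) e q he
  have h2 := dd_line e (pd_smooth α hw) q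
  unfold HasLineDerivAt at h1 h2
  have h3 := h1.inner ℝ h2
  rw [pd_eq_dd α (dd e w), pd_eq_dd β (dd e v), dd_comm _ e hw, dd_comm _ e hv, ← pd_eq_dd,
    ← pd_eq_dd]
  simpa using h3

theorem WS_dd (hδ : 0 < δ) (hA : CoeffsOne δ A) {Ω : Set (ℝ × Ed d)} {v : ℝ × Ed d → Em m}
    (hv : ContDiff ℝ (⊤ : ℕ∞) v) (hw : WS A Ω v) (e : ℝ × Ed d) (he : e.2 0 = 0) :
    WS A Ω (dd e v) := by
  intro φ hφ hc hs
  have h0 := hw (dd e φ) (dd_smooth e hφ) (dd_compact e hc) ((dd_tsupport e φ).trans hs)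
  have hpt : ContDiff ℝ (⊤ : ℕ∞) (pt v) := dd_smooth _ hv
  have i1 : Integrable fun q => ⟪pt v q, φ q⟫ + Bf A v φ q :=
    (inner_int hpt hφ hc).add (Bf_int hδ hA hv hφ hc)
  have i2 : Integrable fun q => ⟪pt v q, dd e φ q⟫ + Bf A v (dd e φ) q :=
    (inner_int hpt (dd_smooth e hφ) (dd_compact e hc)).add
      (Bf_int hδ hA hv (dd_smooth e hφ) (dd_compact e hc))
  have i3 : Integrable fun q => ⟪pt (dd e v) q, φ q⟫ + Bf A (dd e v) φ q :=
    (inner_int (dd_smooth _ (dd_smooth e hv)) hφ hc).add (Bf_int hδ hA (dd_smooth e hv) hφ hc)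
  have key := int_line_zero (e := e) i1 (i2.add i3) (fun q => by
    have a := inner_line hpt hφ e q
    have b := Bf_line (A := A) hv hφ e q he
    unfold HasLineDerivAt at *
    have c := a.add b
    rw [pt_eq_dd, dd_comm e (1,0) hv, ← pt_eq_dd, ← pt_eq_dd] at c
    refine c.congr_deriv ?_
    simp only [Pi.add_apply]
    ring)
  simp only [Pi.add_apply] at key
  rw [integral_add i2 i3, h0, zero_add] at key
  exact key

theorem WS_of_weak (hδ : 0 < δ) (hA : CoeffsOne δ A) {Ω : Set (ℝ × Ed d)} {v : ℝ × Ed d → Em m}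
    (hv : ContDiff ℝ (⊤ : ℕ∞) v)
    (h : ∀ φt : ℝ × Ed d → Em m, ContDiff ℝ (⊤ : ℕ∞) φt → HasCompactSupport φt →
      tsupport φt ⊆ Ω →
      ∫ q, (⟪v q, pt φt q⟫ - ∑ α, ∑ β, ⟪A α β (q.2 0) (pd β v q), pd α φt q⟫) = 0) :
    WS A Ω v := by
  intro φ hφ hc hs
  have h0 := h φ hφ hc hs
  have hpt : ContDiff ℝ (⊤ : ℕ∞) (pt v) := dd_smooth _ hv
  have hpφ : ContDiff ℝ (⊤ : ℕ∞) (pt φ) := dd_smooth _ hφ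
  have hcφ : HasCompactSupport (pt φ) := dd_compact _ hc
  have i1 := inner_int hv hpφ hcφ
  have i2 := inner_int hpt hφ hc
  have i3 := Bf_int hδ hA hv hφ hc
  change ∫ q, (⟪v q, pt φ q⟫ - Bf A v φ q) = 0 at h0
  have key := int_line_zero (inner_int hv hφ hc) (i1.add i2)
    (fun q => inner_line hv hφ (1,0) q)
  simp only [Pi.add_apply] at key
  rw [integral_add i1 i2] at key
  rw [integral_sub i1 i3] at h0
  rw [integral_add i2 i3]
  linarith

theorem Bf_smul (hδ : 0 < δ) (hA : CoeffsOne δ A) {v w : ℝ × Ed d → Em m} {s : ℝ × Ed d → ℝ}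
    (hw : ContDiff ℝ (⊤ : ℕ∞) w) (hs : ContDiff ℝ (⊤ : ℕ∞) s) (q : ℝ × Ed d) {c : ℝ}
    (hc : ∀ α, |pd α s q| ≤ c) :
    |Bf A v (fun p => s p • w p) q - s q * Bf A v w q|
      ≤ (d:ℝ) ^ 2 * δ⁻¹ * c * (√(gradSq v q) * ‖w q‖) := by
  have e1 : Bf A v (fun p => s p • w p) q - s q * Bf A v w q
      = ∑ α, ∑ β, pd α s q * ⟪A α β (q.2 0) (pd β v q), w q⟫ := by
    unfold Bf
    simp_rw [Finset.mul_sum, ← Finset.sum_sub_distrib]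
    refine Finset.sum_congr rfl fun α _ => Finset.sum_congr rfl fun β _ => ?_
    rw [pd_eq_dd α (fun p => s p • w p), dd_mul _ hs hw, inner_add_right, inner_smul_right, inner_smul_right]
    rw [pd_eq_dd α w, pd_eq_dd α s]
    ring
  rw [e1]
  calc _ ≤ ∑ α : Fin d, ∑ β : Fin d, δ⁻¹ * c * (√(gradSq v q) * ‖w q‖) := by
        refine (Finset.abs_sum_le_sum_abs _ _).trans (Finset.sum_le_sum fun α _ => ?_)
        refine (Finset.abs_sum_le_sum_abs _ _).trans (Finset.sum_le_sum fun β _ => ?_)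
        rw [abs_mul]
        have hc0 : 0 ≤ c := (abs_nonneg _).trans (hc α)
        calc _ ≤ c * (‖A α β (q.2 0) (pd β v q)‖ * ‖w q‖) := by
              gcongr
              · exact hc α
              · exact abs_real_inner_le_norm _ _
          _ ≤ c * ((δ⁻¹ * ‖pd β v q‖) * ‖w q‖) := by gcongr; exact A_bound hA _ _ _ _
          _ ≤ c * ((δ⁻¹ * √(gradSq v q)) * ‖w q‖) := by
            gcongr; apply pd_le
          _ = _ := by ring
    _ = _ := by simp; ring

end bform

/-! ### Weighted energy estimates -/

/-- Cutoff functions; the bound on the time derivative is one-sided. -/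
structure Cut {d : ℕ} (C : ℝ) (Ω : Set (ℝ × Ed d)) (ζ : ℝ × Ed d → ℝ) : Prop where
  sm : ContDiff ℝ (⊤ : ℕ∞) ζ
  cpt : HasCompactSupport ζ
  sub : tsupport ζ ⊆ Ω
  nn : ∀ q, 0 ≤ ζ q
  le1 : ∀ q, ζ q ≤ 1
  gx : ∀ α q, |pd α ζ q| ≤ C
  gt : ∀ q, pt ζ q ≤ C

/-- weighted L2 norm squared -/
def Jn {d m : ℕ} (ζ : ℝ × Ed d → ℝ) (k : ℕ) (v : ℝ × Ed d → Em m) : ℝ :=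
  ∫ q, ζ q ^ (2 * k) * ‖v q‖ ^ 2

/-- weighted energy -/
def En {d m : ℕ} (ζ : ℝ × Ed d → ℝ) (k : ℕ) (v : ℝ × Ed d → Em m) : ℝ :=
  ∫ q, ζ q ^ (2 * k) * gradSq v q

section energy
variable {d m : ℕ} {C : ℝ} {Ω : Set (ℝ × Ed d)} {ζ : ℝ × Ed d → ℝ}

theorem Cut.zero (hζ : Cut C Ω ζ) {q : ℝ × Ed d} (hq : q ∉ tsupport ζ) : ζ q = 0 :=
  image_eq_zero_of_notMem_tsupport hq

theorem Cut.C_nonneg (hζ : Cut C Ω ζ) [NeZero d] : 0 ≤ C := (abs_nonneg _).trans (hζ.gx 0 0)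

theorem Cut.int (hζ : Cut C Ω ζ) {n : ℕ} (hn : n ≠ 0) {f : ℝ × Ed d → ℝ} (hf : Continuous f) :
    Integrable (fun q => ζ q ^ n * f q) := by
  refine int_cont hζ.cpt.isCompact ((hζ.sm.continuous.pow n).mul hf) fun q hq => ?_
  simp [hζ.zero hq, hn]

theorem Jn_mono (hζ : Cut C Ω ζ) {k l : ℕ} (hk : k ≠ 0) (hkl : k ≤ l) {v : ℝ × Ed d → Em m}
    (hv : ContDiff ℝ (⊤ : ℕ∞) v) : Jn ζ l v ≤ Jn ζ k v := by
  refine integral_mono (hζ.int (by omega) (hv.continuous.norm.pow 2))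
    (hζ.int (by omega) (hv.continuous.norm.pow 2)) fun q => ?_
  have := hζ.nn q
  have := pow_le_pow_of_le_one (hζ.nn q) (hζ.le1 q) (show 2 * k ≤ 2 * l by omega)
  dsimp only
  gcongr

theorem En_mono (hζ : Cut C Ω ζ) {k l : ℕ} (hk : k ≠ 0) (hkl : k ≤ l) {v : ℝ × Ed d → Em m}
    (hv : ContDiff ℝ (⊤ : ℕ∞) v) : En ζ l v ≤ En ζ k v := by
  refine integral_mono (hζ.int (by omega) (gradSq_cont hv))
    (hζ.int (by omega) (gradSq_cont hv)) fun q => ?_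
  have := hζ.nn q
  have := pow_le_pow_of_le_one (hζ.nn q) (hζ.le1 q) (show 2 * k ≤ 2 * l by omega)
  have := gradSq_nonneg v q
  dsimp only
  gcongr

theorem Jn_pd_le (hζ : Cut C Ω ζ) {k : ℕ} (hk : k ≠ 0) (α : Fin d) {v : ℝ × Ed d → Em m}
    (hv : ContDiff ℝ (⊤ : ℕ∞) v) : Jn ζ k (pd α v) ≤ En ζ k v := by
  refine integral_mono (hζ.int (by omega) ((pd_smooth α hv).continuous.norm.pow 2))
    (hζ.int (by omega) (gradSq_cont hv)) fun q => ?_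
  have := hζ.nn q
  have := pd_sq_le α v q
  dsimp only
  gcongr

theorem Jn_nonneg (hζ : Cut C Ω ζ) (k : ℕ) (v : ℝ × Ed d → Em m) : 0 ≤ Jn ζ k v :=
  integral_nonneg fun q => by have := hζ.nn q; positivity

theorem En_nonneg (hζ : Cut C Ω ζ) (k : ℕ) (v : ℝ × Ed d → Em m) : 0 ≤ En ζ k v :=
  integral_nonneg fun q => by have := hζ.nn q; have := gradSq_nonneg v q; positivity

variable [NeZero d] {δ : ℝ} {A : Fin d → Fin d → ℝ → CLM m}

theorem Cut.pd_pow (hζ : Cut C Ω ζ) (k : ℕ) (α : Fin d) (q : ℝ × Ed d) :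
    |pd α (fun p => ζ p ^ (2 * k + 2)) q| ≤ (2 * (k:ℝ) + 2) * ζ q ^ (2 * k + 1) * C := by
  have h := dd_pow (0, EuclideanSpace.single α 1) hζ.sm (2 * k + 1) q
  rw [pd_eq_dd]
  rw [h, ← pd_eq_dd, abs_mul]
  have := hζ.nn q
  have h1 : (((2 * k + 1 : ℕ) : ℝ) + 1) * ζ q ^ (2 * k + 1)
      = (2 * (k:ℝ) + 2) * ζ q ^ (2 * k + 1) := by push_cast; ring
  rw [h1, abs_of_nonneg (by positivity)]
  gcongr
  exact hζ.gx α q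

theorem C1 (hδ : 0 < δ) (C : ℝ) (k : ℕ) (hk : k ≠ 0) : ∃ N : ℝ, 0 ≤ N ∧
    ∀ (A : Fin d → Fin d → ℝ → CLM m) (Ω : Set (ℝ × Ed d)) (ζ : ℝ × Ed d → ℝ)
      (v : ℝ × Ed d → Em m), CoeffsOne δ A → Cut C Ω ζ → ContDiff ℝ (⊤ : ℕ∞) v → WS A Ω v →
      En ζ (k+1) v ≤ N * Jn ζ k v := by
  set L : ℝ := (2 * (k:ℝ) + 2) * ((d:ℝ) ^ 2 * δ⁻¹ * C) with hL
  refine ⟨2 / δ * (((k:ℝ)+1) * |C| + L ^ 2 / (2 * δ)), by positivity, ?_⟩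
  intro A Ω ζ v hA hζ hv hw
  have hC := hζ.C_nonneg
  have hpt : ContDiff ℝ (⊤ : ℕ∞) (pt v) := dd_smooth _ hv
  have hz : ContDiff ℝ (⊤ : ℕ∞) (fun q => ζ q ^ (2 * k + 2)) := hζ.sm.pow _
  have hφ : ContDiff ℝ (⊤ : ℕ∞) (fun q => ζ q ^ (2 * k + 2) • v q) := hz.smul hv
  have hsub : tsupport (fun q => ζ q ^ (2 * k + 2) • v q) ⊆ tsupport ζ := by
    refine closure_mono fun q hq => ?_
    simp only [mem_support] at hq ⊢
    intro h; apply hq; simp [h]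
  have hcφ : HasCompactSupport (fun q => ζ q ^ (2 * k + 2) • v q) :=
    hζ.cpt.isCompact.of_isClosed_subset (isClosed_tsupport _) hsub
  have h0 := hw _ hφ hcφ (hsub.trans hζ.sub)
  have i0 := (inner_int hpt hφ hcφ).add (Bf_int hδ hA hv hφ hcφ)
  -- time term
  have i1 := inner_int hv hφ hcφ
  have hdφ : ContDiff ℝ (⊤ : ℕ∞) (dd (1,0) (fun q => ζ q ^ (2 * k + 2) • v q)) := dd_smooth _ hφ
  have i2 := (inner_int hv hdφ (dd_compact _ hcφ)).add (inner_int hpt hφ hcφ)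
  have h1 := int_line_zero i1 i2 (fun q => inner_line hv hφ (1,0) q)
  have iE := hζ.int (n := 2 * (k+1)) (by omega) (gradSq_cont hv)
  have iJ := hζ.int (n := 2 * k) (by omega) (hv.continuous.norm.pow 2)
  have key : ∀ q, δ / 2 * (ζ q ^ (2 * (k+1)) * gradSq v q) ≤
      (⟪pt v q, ζ q ^ (2 * k + 2) • v q⟫ + Bf A v (fun q => ζ q ^ (2 * k + 2) • v q) q)
      - (1/2) * (⟪v q, dd (1,0) (fun q => ζ q ^ (2 * k + 2) • v q) q⟫
          + ⟪pt v q, ζ q ^ (2 * k + 2) • v q⟫)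
      + (((k:ℝ)+1) * |C| + L ^ 2 / (2 * δ)) * (ζ q ^ (2 * k) * ‖v q‖ ^ 2) := by
    intro q
    have hz0 := hζ.nn q
    have hz1 := hζ.le1 q
    have b1 := Bf_smul (v := v) hδ hA hv hz q (fun α => hζ.pd_pow k α q)
    have b2 := Bf_ell hA v q
    rw [dd_mul _ hz hv, dd_pow _ hζ.sm (2 * k + 1), ← pt_eq_dd, ← pt_eq_dd]
    simp only [inner_add_right, inner_smul_right, real_inner_self_eq_norm_sq]
    rw [real_inner_comm (pt v q) (v q)]
    have hG := gradSq_nonneg v q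
    set G := gradSq v q
    set g := √G with hg
    have hgg : G = g ^ 2 := (Real.sq_sqrt hG).symm
    have hg0 : 0 ≤ g := Real.sqrt_nonneg _
    set I := ⟪v q, pt v q⟫
    set n := ‖v q‖
    have hn0 : 0 ≤ n := norm_nonneg _
    set z := ζ q
    set B1 := Bf A v (fun q => ζ q ^ (2 * k + 2) • v q) q
    set B0 := Bf A v v q
    have e1 : z ^ (2 * (k+1)) = (z ^ k * z) ^ 2 := by ring
    have e2 : z ^ (2 * k + 2) = (z ^ k * z) ^ 2 := by ring
    have e3 : z ^ (2 * k + 1) = z ^ k * z * z ^ k := by ring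
    have e4 : z ^ (2 * k) = (z ^ k) ^ 2 := by ring
    rw [e1, e2, e3, e4]
    rw [e2, e3] at b1
    set y := z ^ k with hy
    have hy0 : 0 ≤ y := by positivity
    have c1 := (abs_le.1 b1).1
    have c2 : (y*z)^2 * (δ * G) ≤ (y*z)^2 * B0 := by gcongr
    have c3 : y * z * y * pt ζ q * n ^ 2 ≤ y ^ 2 * n ^ 2 * |C| := by
      have : pt ζ q ≤ |C| := (hζ.gt q).trans (le_abs_self _)
      calc _ = (y ^ 2 * n ^ 2) * z * pt ζ q := by ring
        _ ≤ (y ^ 2 * n ^ 2) * z * |C| := by gcongr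
        _ ≤ (y ^ 2 * n ^ 2) * 1 * |C| := by gcongr
        _ = _ := by ring
    have c4 : L * (y * z * g) * (y * n) ≤ δ / 2 * (y * z * g) ^ 2 + L ^ 2 / (2 * δ) * (y * n) ^ 2 := by
      have : 0 ≤ (δ * (y * z * g) - L * (y * n)) ^ 2 / (2 * δ) := by positivity
      have e : (δ * (y * z * g) - L * (y * n)) ^ 2 / (2 * δ) =
        δ / 2 * (y * z * g) ^ 2 + L ^ 2 / (2 * δ) * (y * n) ^ 2 - L * (y * z * g) * (y * n) := by
        field_simp; ring
      linarith
    have c5 : (d:ℝ) ^ 2 * δ⁻¹ * ((2 * (k:ℝ) + 2) * (y * z * y) * C) * (g * n)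
        = L * (y * z * g) * (y * n) := by rw [hL]; ring
    rw [c5] at c1
    rw [hgg] at c2 ⊢
    have hk0 : (0:ℝ) ≤ (k:ℝ) + 1 := by positivity
    have c6 := mul_le_mul_of_nonneg_left c3 hk0
    push_cast
    linarith [c1, c2, c4, c6]
  have hIneq := integral_mono (iE.const_mul (δ/2)) ((i0.sub (i2.const_mul (1/2))).add
    (iJ.const_mul (((k:ℝ)+1) * |C| + L ^ 2 / (2 * δ)))) key
  rw [integral_const_mul, integral_add' (i0.sub (i2.const_mul (1/2))) (iJ.const_mul _),
    integral_sub' i0 (i2.const_mul (1/2)), integral_const_mul, integral_const_mul, h1] at hIneq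
  simp only [Pi.add_apply] at hIneq
  rw [h0] at hIneq
  change δ / 2 * En ζ (k+1) v ≤ 0 - 1 / 2 * 0 + _ * Jn ζ k v at hIneq
  have := mul_le_mul_of_nonneg_left hIneq (show 0 ≤ 2 / δ by positivity)
  calc En ζ (k+1) v = 2 / δ * (δ / 2 * En ζ (k+1) v) := by field_simp
    _ ≤ _ := this
    _ = _ := by ring

theorem C2 (hδ : 0 < δ) (C : ℝ) (k : ℕ) (hk : k ≠ 0) : ∃ N : ℝ, 0 ≤ N ∧
    ∀ (A : Fin d → Fin d → ℝ → CLM m) (Ω : Set (ℝ × Ed d)) (ζ : ℝ × Ed d → ℝ)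
      (v : ℝ × Ed d → Em m), CoeffsOne δ A → Cut C Ω ζ → ContDiff ℝ (⊤ : ℕ∞) v → WS A Ω v →
      Jn ζ (k+1) (pt v) ≤ N * En ζ k v := by
  obtain ⟨N1, hN1, H1⟩ := C1 (d := d) (m := m) hδ C (k+1) (by omega)
  set K : ℝ := (d:ℝ) ^ 2 * δ⁻¹ with hK
  set L : ℝ := (2 * (k:ℝ) + 2) * (K * C) with hL
  have hK0 : 0 ≤ K := by positivity
  set ε : ℝ := 1 / (4 * (N1 + 1)) with hε
  have hε0 : 0 < ε := by positivity
  refine ⟨4 * (K ^ 2 / (4 * ε) + L ^ 2 / 2), by positivity, ?_⟩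
  intro A Ω ζ v hA hζ hv hw
  have hC := hζ.C_nonneg
  have hpt : ContDiff ℝ (⊤ : ℕ∞) (pt v) := dd_smooth _ hv
  have hwt : WS A Ω (pt v) := WS_dd hδ hA hv hw (1,0) (by simp)
  have hz : ContDiff ℝ (⊤ : ℕ∞) (fun q => ζ q ^ (2 * k + 2)) := hζ.sm.pow _
  have hφ : ContDiff ℝ (⊤ : ℕ∞) (fun q => ζ q ^ (2 * k + 2) • pt v q) := hz.smul hpt
  have hsub : tsupport (fun q => ζ q ^ (2 * k + 2) • pt v q) ⊆ tsupport ζ := by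
    refine closure_mono fun q hq => ?_
    simp only [mem_support] at hq ⊢
    intro h; apply hq; simp [h]
  have hcφ : HasCompactSupport (fun q => ζ q ^ (2 * k + 2) • pt v q) :=
    hζ.cpt.isCompact.of_isClosed_subset (isClosed_tsupport _) hsub
  have h0 := hw _ hφ hcφ (hsub.trans hζ.sub)
  have i0 := (inner_int hpt hφ hcφ).add (Bf_int hδ hA hv hφ hcφ)
  have iE := hζ.int (n := 2 * k) (by omega) (gradSq_cont hv)
  have iE2 := hζ.int (n := 2 * (k+1+1)) (by omega) (gradSq_cont hpt)
  have iJ := hζ.int (n := 2 * (k+1)) (by omega) (hpt.continuous.norm.pow 2)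
  have key : ∀ q, 1 / 2 * (ζ q ^ (2 * (k+1)) * ‖pt v q‖ ^ 2) ≤
      (⟪pt v q, ζ q ^ (2 * k + 2) • pt v q⟫ + Bf A v (fun q => ζ q ^ (2 * k + 2) • pt v q) q)
      + ε * (ζ q ^ (2 * (k+1+1)) * gradSq (pt v) q)
      + (K ^ 2 / (4 * ε) + L ^ 2 / 2) * (ζ q ^ (2 * k) * gradSq v q) := by
    intro q
    have hz0 := hζ.nn q
    have b1 := Bf_smul (v := v) hδ hA hpt hz q (fun α => hζ.pd_pow k α q)
    have b2 := Bf_bound hδ hA v (pt v) q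
    simp only [inner_smul_right, real_inner_self_eq_norm_sq]
    have hG := gradSq_nonneg v q
    have hG' := gradSq_nonneg (pt v) q
    set G := gradSq v q
    set g := √G with hg
    have hgg : G = g ^ 2 := (Real.sq_sqrt hG).symm
    have hg0 : 0 ≤ g := Real.sqrt_nonneg _
    set G' := gradSq (pt v) q
    set g' := √G' with hg'
    have hgg' : G' = g' ^ 2 := (Real.sq_sqrt hG').symm
    have hg0' : 0 ≤ g' := Real.sqrt_nonneg _
    set n := ‖pt v q‖
    set z := ζ q
    set B1 := Bf A v (fun q => ζ q ^ (2 * k + 2) • pt v q) q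
    set B0 := Bf A v (pt v) q
    have e1 : z ^ (2 * (k+1)) = (z ^ k * z) ^ 2 := by ring
    have e2 : z ^ (2 * k + 2) = (z ^ k * z) ^ 2 := by ring
    have e3 : z ^ (2 * k + 1) = z ^ k * z * z ^ k := by ring
    have e4 : z ^ (2 * k) = (z ^ k) ^ 2 := by ring
    have e5 : z ^ (2 * (k+1+1)) = (z ^ k * z * z) ^ 2 := by ring
    rw [e1, e2, e4, e5]
    rw [e2, e3] at b1
    set y := z ^ k with hy
    have hy0 : 0 ≤ y := by positivity
    have c1 := (abs_le.1 b1).1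
    have c2 : -((y*z)^2 * (K * (g * g'))) ≤ (y*z)^2 * B0 := by
      have := mul_le_mul_of_nonneg_left (abs_le.1 b2).1 (sq_nonneg (y*z))
      linarith
    have c4 : L * (y * z * n) * (y * g) ≤ 1 / 2 * (y * z * n) ^ 2 + L ^ 2 / 2 * (y * g) ^ 2 := by
      nlinarith [sq_nonneg (y * z * n - L * (y * g))]
    have c7 : (K * (y * g)) * (y * z * z * g') ≤ ε * (y * z * z * g') ^ 2
        + K ^ 2 / (4 * ε) * (y * g) ^ 2 := by
      have : 0 ≤ (2 * ε * (y * z * z * g') - K * (y * g)) ^ 2 / (4 * ε) := by positivity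
      have e : (2 * ε * (y * z * z * g') - K * (y * g)) ^ 2 / (4 * ε) =
        ε * (y * z * z * g') ^ 2 + K ^ 2 / (4 * ε) * (y * g) ^ 2
          - (K * (y * g)) * (y * z * z * g') := by
        field_simp; ring
      linarith
    have c5 : K * ((2 * (k:ℝ) + 2) * (y * z * y) * C) * (g * n)
        = L * (y * z * n) * (y * g) := by rw [hL]; ring
    rw [c5] at c1
    rw [hgg, hgg']
    linarith [c1, c2, c4, c7]
  have hIneq := integral_mono (iJ.const_mul (1/2)) ((i0.add (iE2.const_mul ε)).add
    (iE.const_mul (K ^ 2 / (4 * ε) + L ^ 2 / 2))) key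
  rw [integral_const_mul, integral_add' (i0.add (iE2.const_mul ε)) (iE.const_mul _),
    integral_add' i0 (iE2.const_mul ε), integral_const_mul, integral_const_mul] at hIneq
  simp only [Pi.add_apply] at hIneq
  rw [h0] at hIneq
  change 1 / 2 * Jn ζ (k+1) (pt v) ≤ 0 + ε * En ζ (k+1+1) (pt v) + _ * En ζ k v at hIneq
  have h2 := H1 A Ω ζ (pt v) hA hζ hpt hwt
  have hJ := Jn_nonneg hζ (k+1) (pt v)
  have h3 : ε * En ζ (k+1+1) (pt v) ≤ 1 / 4 * Jn ζ (k+1) (pt v) := by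
    calc _ ≤ ε * (N1 * Jn ζ (k+1) (pt v)) := by gcongr
      _ ≤ ε * ((N1 + 1) * Jn ζ (k+1) (pt v)) := by gcongr; linarith
      _ = _ := by rw [hε]; field_simp
  linarith

end energy

/-! ### Iterated derivatives in the good directions -/

/-- Good directions: `0` encodes time, `α ≠ 0` encodes `x_α`. -/
def adir {d : ℕ} [NeZero d] (α : Fin d) : ℝ × Ed d :=
  if α = 0 then (1, 0) else (0, EuclideanSpace.single α 1)

/-- Iterated derivatives in good directions. -/
def DL {d m : ℕ} [NeZero d] : List (Fin d) → (ℝ × Ed d → Em m) → (ℝ × Ed d → Em m)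
  | [], u => u
  | α :: L, u => dd (adir α) (DL L u)

section iter
variable {d m : ℕ} [NeZero d] {δ C : ℝ} {Ω : Set (ℝ × Ed d)} {ζ : ℝ × Ed d → ℝ}
  {A : Fin d → Fin d → ℝ → CLM m}

theorem adir_adm (α : Fin d) : (adir α).2 0 = 0 := by
  unfold adir
  split_ifs with h
  · simp
  · simp [Ne.symm h]

theorem dd_adir_zero (v : ℝ × Ed d → Em m) : dd (adir 0) v = pt v := by
  simp [adir, pt_eq_dd]

theorem dd_adir_ne {α : Fin d} (hα : α ≠ 0) (v : ℝ × Ed d → Em m) : dd (adir α) v = pd α v := by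
  simp [adir, pd_eq_dd, hα]

theorem DL_smooth (L : List (Fin d)) {u : ℝ × Ed d → Em m} (hu : ContDiff ℝ (⊤ : ℕ∞) u) :
    ContDiff ℝ (⊤ : ℕ∞) (DL L u) := by
  induction L with
  | nil => exact hu
  | cons α L ih => exact dd_smooth _ ih

theorem DL_dd (L : List (Fin d)) {u : ℝ × Ed d → Em m} (hu : ContDiff ℝ (⊤ : ℕ∞) u)
    (e : ℝ × Ed d) : DL L (dd e u) = dd e (DL L u) := by
  induction L with
  | nil => rfl
  | cons α L ih => simp only [DL]; rw [ih, dd_comm _ _ (DL_smooth L hu)]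

theorem DL_append (L L' : List (Fin d)) (u : ℝ × Ed d → Em m) :
    DL (L ++ L') u = DL L (DL L' u) := by
  induction L with
  | nil => rfl
  | cons α L ih => simp only [DL, List.cons_append]; rw [ih]

theorem DL_WS (hδ : 0 < δ) (hA : CoeffsOne δ A) (L : List (Fin d)) {u : ℝ × Ed d → Em m}
    (hu : ContDiff ℝ (⊤ : ℕ∞) u) (hw : WS A Ω u) : WS A Ω (DL L u) := by
  induction L with
  | nil => exact hw
  | cons α L ih => exact WS_dd hδ hA (DL_smooth L hu) ih _ (adir_adm α)

theorem step_J (hδ : 0 < δ) (C : ℝ) (k : ℕ) (hk : k ≠ 0) : ∃ N : ℝ, 0 ≤ N ∧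
    ∀ (A : Fin d → Fin d → ℝ → CLM m) (Ω : Set (ℝ × Ed d)) (ζ : ℝ × Ed d → ℝ)
      (v : ℝ × Ed d → Em m), CoeffsOne δ A → Cut C Ω ζ → ContDiff ℝ (⊤ : ℕ∞) v → WS A Ω v →
      ∀ α, Jn ζ (k+1) (dd (adir α) v) ≤ N * En ζ k v := by
  obtain ⟨N, hN, H⟩ := C2 (d := d) (m := m) hδ C k hk
  refine ⟨N + 1, by positivity, fun A Ω ζ v hA hζ hv hw α => ?_⟩
  have hE := En_nonneg hζ k v
  by_cases hα : α = 0
  · subst hα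
    rw [dd_adir_zero]
    have := H A Ω ζ v hA hζ hv hw
    linarith
  · rw [dd_adir_ne hα]
    have h1 := Jn_mono hζ hk (Nat.le_succ k) (pd_smooth α hv)
    have h2 := Jn_pd_le hζ hk α hv
    have : 0 ≤ N * En ζ k v := by positivity
    simp only [Nat.succ_eq_add_one] at h1
    linarith

theorem step_E (hδ : 0 < δ) (C : ℝ) (k : ℕ) (hk : k ≠ 0) : ∃ N : ℝ, 0 ≤ N ∧
    ∀ (A : Fin d → Fin d → ℝ → CLM m) (Ω : Set (ℝ × Ed d)) (ζ : ℝ × Ed d → ℝ)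
      (v : ℝ × Ed d → Em m), CoeffsOne δ A → Cut C Ω ζ → ContDiff ℝ (⊤ : ℕ∞) v → WS A Ω v →
      ∀ α, En ζ (k+2) (dd (adir α) v) ≤ N * En ζ k v := by
  obtain ⟨N, hN, H⟩ := step_J (d := d) (m := m) hδ C k hk
  obtain ⟨N', hN', H'⟩ := C1 (d := d) (m := m) hδ C (k+1) (by omega)
  refine ⟨N' * N, by positivity, fun A Ω ζ v hA hζ hv hw α => ?_⟩
  calc _ ≤ N' * Jn ζ (k+1) (dd (adir α) v) :=
        H' A Ω ζ _ hA hζ (dd_smooth _ hv) (WS_dd hδ hA hv hw _ (adir_adm α))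
    _ ≤ N' * (N * En ζ k v) := by gcongr; exact H A Ω ζ v hA hζ hv hw α
    _ = _ := by ring

theorem iter_E (hδ : 0 < δ) (C : ℝ) (n : ℕ) : ∃ N : ℝ, 0 ≤ N ∧
    ∀ (A : Fin d → Fin d → ℝ → CLM m) (Ω : Set (ℝ × Ed d)) (ζ : ℝ × Ed d → ℝ)
      (v : ℝ × Ed d → Em m), CoeffsOne δ A → Cut C Ω ζ → ContDiff ℝ (⊤ : ℕ∞) v → WS A Ω v →
      ∀ L : List (Fin d), L.length ≤ n → En ζ (2 * n + 1) (DL L v) ≤ N * En ζ 1 v := by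
  induction n with
  | zero =>
    refine ⟨1, by positivity, fun A Ω ζ v hA hζ hv hw L hL => ?_⟩
    have : L = [] := List.eq_nil_of_length_eq_zero (by omega)
    subst this
    simp [DL]
  | succ n ih =>
    obtain ⟨N, hN, H⟩ := ih
    obtain ⟨N', hN', H'⟩ := step_E (d := d) (m := m) hδ C (2 * n + 1) (by omega)
    refine ⟨N' * N + 1, by positivity, fun A Ω ζ v hA hζ hv hw L hL => ?_⟩
    have hE := En_nonneg hζ 1 v
    have hE' : 0 ≤ N' * N * En ζ 1 v := by positivity
    match L, hL with
    | [], _ =>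
      have := En_mono hζ one_ne_zero (show 1 ≤ 2 * (n+1) + 1 by omega) hv
      simp only [DL]
      linarith
    | α :: L, hL =>
      simp only [List.length_cons] at hL
      have h1 := H' A Ω ζ _ hA hζ (DL_smooth L hv) (DL_WS hδ hA L hv hw) α
      have h2 := mul_le_mul_of_nonneg_left (H A Ω ζ v hA hζ hv hw L (by omega)) hN'
      simp only [DL]
      rw [show 2 * (n+1) + 1 = 2 * n + 1 + 2 by ring]
      linarith

/-- The quantities to be bounded: `D_β D' u` and `u_t`. -/
theorem iter_J (hδ : 0 < δ) (C : ℝ) (n : ℕ) : ∃ N : ℝ, 0 ≤ N ∧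
    ∀ (A : Fin d → Fin d → ℝ → CLM m) (Ω : Set (ℝ × Ed d)) (ζ : ℝ × Ed d → ℝ)
      (v : ℝ × Ed d → Em m), CoeffsOne δ A → Cut C Ω ζ → ContDiff ℝ (⊤ : ℕ∞) v → WS A Ω v →
      ∀ L : List (Fin d), L.length ≤ n →
        (∀ α β, Jn ζ (2 * n + 3) (DL L (pd β (dd (adir α) v))) ≤ N * En ζ 1 v) ∧
        Jn ζ (2 * n + 3) (DL L (pt v)) ≤ N * En ζ 1 v := by
  obtain ⟨N, hN, H⟩ := iter_E (d := d) (m := m) hδ C (n+1)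
  obtain ⟨N1, hN1, H1⟩ := iter_E (d := d) (m := m) hδ C n
  obtain ⟨N', hN', H'⟩ := step_J (d := d) (m := m) hδ C (2 * n + 1) (by omega)
  refine ⟨N + N' * N1, by positivity, fun A Ω ζ v hA hζ hv hw L hL => ⟨fun α β => ?_, ?_⟩⟩
  · have hE := En_nonneg hζ 1 v
    have hE' : 0 ≤ N' * N1 * En ζ 1 v := by positivity
    have h1 := H A Ω ζ v hA hζ hv hw (L ++ [α]) (by simp; omega)
    rw [DL_append] at h1
    have h2 := Jn_pd_le hζ (show 2 * (n+1) + 1 ≠ 0 by omega) β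
      (DL_smooth L (DL_smooth [α] hv))
    rw [pd_eq_dd, DL_dd _ (dd_smooth _ hv), ← pd_eq_dd]
    change Jn ζ (2 * n + 3) (pd β (DL L (DL [α] v))) ≤ _
    rw [show 2 * n + 3 = 2 * (n+1) + 1 by ring]
    linarith
  · have hE := En_nonneg hζ 1 v
    have hE' : 0 ≤ N * En ζ 1 v := by positivity
    have h1 := H' A Ω ζ _ hA hζ (DL_smooth L hv) (DL_WS hδ hA L hv hw) 0
    have h2 := mul_le_mul_of_nonneg_left (H1 A Ω ζ v hA hζ hv hw L hL) hN'
    rw [← dd_adir_zero, DL_dd _ hv]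
    have h3 := Jn_mono hζ (show 2 * n + 1 + 1 ≠ 0 by omega) (show 2 * n + 1 + 1 ≤ 2 * n + 3 by omega)
      (dd_smooth (adir 0) (DL_smooth L hv))
    linarith

/-! ### Weights and anisotropic Sobolev bound -/

/-- coordinates -/
def cc (α : Fin d) (q : ℝ × Ed d) : ℝ := if α = 0 then q.1 else q.2 α
/-- scales -/
def rr (ρ : ℝ) (α : Fin d) : ℝ := if α = 0 then ρ ^ 2 else ρ
/-- weight -/
def wt (ρ : ℝ) (α : Fin d) (q : ℝ × Ed d) : ℝ := 1 / (1 + (cc α q / rr ρ α) ^ 2)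
/-- primitive of the weight -/
def th (ρ : ℝ) (α : Fin d) (q : ℝ × Ed d) : ℝ :=
  rr ρ α * (Real.arctan (cc α q / rr ρ α) - Real.pi / 2)
/-- product of weights -/
def WW (ρ : ℝ) (S : Finset (Fin d)) (q : ℝ × Ed d) : ℝ := ∏ α ∈ S, wt ρ α q

theorem rr_pos {ρ : ℝ} (hρ : 0 < ρ) (α : Fin d) : 0 < rr ρ α := by
  unfold rr; split_ifs <;> positivity

theorem cc_cont (α : Fin d) : Continuous (cc α : ℝ × Ed d → ℝ) := by
  unfold cc; split_ifs <;> fun_prop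

theorem wt_cont (ρ : ℝ) (α : Fin d) : Continuous (wt ρ α : ℝ × Ed d → ℝ) := by
  unfold wt
  refine continuous_const.div ?_ (fun q => by positivity)
  have := cc_cont α
  fun_prop

theorem th_cont (ρ : ℝ) (α : Fin d) : Continuous (th ρ α : ℝ × Ed d → ℝ) := by
  unfold th
  have := cc_cont α
  have h : Continuous fun q : ℝ × Ed d => Real.arctan (cc α q / rr ρ α) :=
    Real.continuous_arctan.comp (by fun_prop)
  fun_prop

theorem WW_cont (ρ : ℝ) (S : Finset (Fin d)) : Continuous (WW ρ S : ℝ × Ed d → ℝ) := by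
  unfold WW; exact continuous_finsetProd _ fun α _ => wt_cont ρ α

theorem wt_pos (ρ : ℝ) (α : Fin d) (q : ℝ × Ed d) : 0 < wt ρ α q := by
  unfold wt; positivity

theorem WW_pos (ρ : ℝ) (S : Finset (Fin d)) (q : ℝ × Ed d) : 0 < WW ρ S q :=
  Finset.prod_pos fun α _ => wt_pos ρ α q

theorem cc_line (α β : Fin d) (q : ℝ × Ed d) (t : ℝ) :
    cc α (q + t • adir β) = cc α q + (if α = β then t else 0) := by
  unfold cc adir
  by_cases hα : α = 0 <;> by_cases hβ : β = 0
  · simp [hα, hβ]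
  · simp [hα, hβ, Ne.symm hβ]
  · simp [hα, hβ]
  · simp only [hα, hβ, if_false]
    by_cases h : α = β <;> simp [h]

theorem th_line {ρ : ℝ} (hρ : 0 < ρ) (α : Fin d) (q : ℝ × Ed d) :
    HasLineDerivAt ℝ (th ρ α) (wt ρ α q) q (adir α) := by
  unfold HasLineDerivAt th wt
  simp only [cc_line, if_true]
  have hr := rr_pos hρ α
  have h1 : HasDerivAt (fun t : ℝ => (cc α q + t) / rr ρ α) (1 / rr ρ α) 0 :=
    ((hasDerivAt_id (0:ℝ)).const_add (cc α q)).div_const _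
  have h2 := ((h1.arctan).sub_const (Real.pi / 2)).const_mul (rr ρ α)
  refine h2.congr_deriv ?_
  simp only [add_zero]
  field_simp

theorem WW_line (ρ : ℝ) {α : Fin d} {S : Finset (Fin d)} (hα : α ∉ S) (q : ℝ × Ed d) (t : ℝ) :
    WW ρ S (q + t • adir α) = WW ρ S q := by
  unfold WW
  refine Finset.prod_congr rfl fun β hβ => ?_
  have : β ≠ α := fun h => hα (h ▸ hβ)
  simp [wt, cc_line, this]

/-- weighted L2 norm -/
def Jw (ρ : ℝ) (S : Finset (Fin d)) (ζ : ℝ × Ed d → ℝ) (k : ℕ) (h : ℝ × Ed d → Em m) : ℝ :=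
  ∫ q, ζ q ^ (2 * k) * (WW ρ S q * ‖h q‖ ^ 2)

theorem Cut.ga (hζ : Cut C Ω ζ) (α : Fin d) (q : ℝ × Ed d) : dd (adir α) ζ q ≤ C := by
  by_cases hα : α = 0
  · subst hα
    have := hζ.gt q
    simpa [adir, pt_eq_dd] using this
  · have := (le_abs_self _).trans (hζ.gx α q)
    simpa [adir, hα, pd_eq_dd] using this

theorem sob1 (hζ : Cut C Ω ζ) {ρ : ℝ} (hρ : 0 < ρ) {k : ℕ} (hk : k ≠ 0) {α : Fin d}
    {S : Finset (Fin d)} (hα : α ∉ S) {h : ℝ × Ed d → Em m} (hh : ContDiff ℝ (⊤ : ℕ∞) h) :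
    Jw ρ (insert α S) ζ (k+1) h ≤ Real.pi * ((2 * k + 2) * C + 1) * rr ρ α *
      (Jw ρ S ζ k h + Jw ρ S ζ k (dd (adir α) h)) := by
  have hC := hζ.C_nonneg
  have hz : ContDiff ℝ (⊤ : ℕ∞) (fun q => ζ q ^ (2 * k + 2)) := hζ.sm.pow _
  have hφ : ContDiff ℝ (⊤ : ℕ∞) (fun q => ζ q ^ (2 * k + 2) • h q) := hz.smul hh
  have hsub : tsupport (fun q => ζ q ^ (2 * k + 2) • h q) ⊆ tsupport ζ := by
    refine closure_mono fun q hq => ?_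
    simp only [mem_support] at hq ⊢
    intro h; apply hq; simp [h]
  have hdh : ContDiff ℝ (⊤ : ℕ∞) (dd (adir α) h) := dd_smooth _ hh
  have hdφ := dd_smooth (adir α) hφ
  have cth := th_cont ρ α
  have cwt := wt_cont ρ α
  have cW := WW_cont ρ S
  have ch := hh.continuous
  have cdh := hdh.continuous
  have cφ := hφ.continuous
  have cdφ := hdφ.continuous
  set Z : ℝ × Ed d → ℝ := fun q => ⟪h q, ζ q ^ (2 * k + 2) • h q⟫
  set Z' : ℝ × Ed d → ℝ := fun q => ⟪h q, dd (adir α) (fun q => ζ q ^ (2 * k + 2) • h q) q⟫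
    + ⟪dd (adir α) h q, ζ q ^ (2 * k + 2) • h q⟫
  have cZ : Continuous Z := ch.inner cφ
  have cZ' : Continuous Z' := (ch.inner cdφ).add (cdh.inner cφ)
  have Z0 : ∀ q, q ∉ tsupport ζ → Z q = 0 := fun q hq => by
    simp [Z, hζ.zero hq]
  have Z0' : ∀ q, q ∉ tsupport ζ → Z' q = 0 := fun q hq => by
    have : dd (adir α) (fun q => ζ q ^ (2 * k + 2) • h q) q = 0 := dd_off _ (fun h => hq (hsub h))
    simp [Z', hζ.zero hq, this]
  have i1 : Integrable fun q => th ρ α q * (WW ρ S q * Z q) :=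
    int_cont hζ.cpt.isCompact (by fun_prop) fun q hq => by simp [Z0 q hq]
  have i2 : Integrable fun q => wt ρ α q * (WW ρ S q * Z q) :=
    int_cont hζ.cpt.isCompact (by fun_prop) fun q hq => by simp [Z0 q hq]
  have i3 : Integrable fun q => th ρ α q * (WW ρ S q * Z' q) :=
    int_cont hζ.cpt.isCompact (by fun_prop) fun q hq => by simp [Z0' q hq]
  have h0 := int_line_zero (e := adir α) i1 (i2.add i3) (fun q => by
    have a := th_line hρ α q
    have b : HasLineDerivAt ℝ Z (Z' q) q (adir α) := inner_line hh hφ (adir α) q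
    unfold HasLineDerivAt at *
    simp only [WW_line ρ hα]
    have c := a.mul (b.const_mul (WW ρ S q))
    refine c.congr_deriv ?_
    simp)
  simp only [Pi.add_apply] at h0
  rw [integral_add i2 i3] at h0
  have iA : Integrable fun q => ζ q ^ (2 * k) * (WW ρ S q * ‖h q‖ ^ 2) :=
    hζ.int (by omega) (by fun_prop)
  have iB : Integrable fun q => ζ q ^ (2 * k) * (WW ρ S q * ‖dd (adir α) h q‖ ^ 2) :=
    hζ.int (by omega) (by fun_prop)
  set c : ℝ := Real.pi * ((2 * k + 2) * C + 1) * rr ρ α with hc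
  have key : ∀ q, -(th ρ α q * (WW ρ S q * Z' q)) ≤ c * (ζ q ^ (2 * k) * (WW ρ S q * ‖h q‖ ^ 2)
      + ζ q ^ (2 * k) * (WW ρ S q * ‖dd (adir α) h q‖ ^ 2)) := by
    intro q
    have hz0 := hζ.nn q
    have hz1 := hζ.le1 q
    have hW := (WW_pos ρ S q).le
    have hr := rr_pos hρ α
    have ht0 : 0 ≤ -th ρ α q := by
      unfold th
      have := (Real.arctan_lt_pi_div_two (cc α q / rr ρ α)).le
      nlinarith
    have ht1 : -th ρ α q ≤ Real.pi * rr ρ α := by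
      unfold th
      have := (Real.neg_pi_div_two_lt_arctan (cc α q / rr ρ α)).le
      nlinarith
    have hZ : Z' q ≤ ζ q ^ (2 * k) * (((2 * k + 2) * C + 1) *
        (‖h q‖ ^ 2 + ‖dd (adir α) h q‖ ^ 2)) := by
      simp only [Z']
      rw [dd_mul _ hz hh, dd_pow _ hζ.sm (2 * k + 1)]
      simp only [inner_add_right, inner_smul_right, real_inner_self_eq_norm_sq]
      rw [real_inner_comm (h q) (dd (adir α) h q)]
      have a1 : ⟪h q, dd (adir α) h q⟫ ≤ ‖h q‖ * ‖dd (adir α) h q‖ := real_inner_le_norm _ _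
      have a2 := hζ.ga α q
      set I := ⟪h q, dd (adir α) h q⟫
      set D := dd (adir α) ζ q
      set a := ‖h q‖
      set b := ‖dd (adir α) h q‖
      set z := ζ q
      have e1 : z ^ (2 * k + 2) = z ^ (2 * k) * z ^ 2 := by ring
      have e2 : z ^ (2 * k + 1) = z ^ (2 * k) * z := by ring
      rw [e1, e2]
      have b1 : z * D ≤ C := by
        rcases le_total D 0 with h | h
        · nlinarith
        · nlinarith
      have b2 : 2 * (z ^ 2 * I) ≤ a ^ 2 + b ^ 2 := by
        have : I ≤ (a ^ 2 + b ^ 2) / 2 := by nlinarith [sq_nonneg (a - b)]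
        have hz2 : z ^ 2 ≤ 1 := by nlinarith
        nlinarith [sq_nonneg z, sq_nonneg a, sq_nonneg b]
      have b3 : (2 * (k:ℝ) + 2) * (z * D) * a ^ 2 ≤ (2 * (k:ℝ) + 2) * C * (a ^ 2 + b ^ 2) := by
        have : (2 * (k:ℝ) + 2) * (z * D) * a ^ 2 ≤ (2 * (k:ℝ) + 2) * C * a ^ 2 := by gcongr
        have : 0 ≤ (2 * (k:ℝ) + 2) * C * b ^ 2 := by positivity
        linarith
      have b4 := mul_le_mul_of_nonneg_left (add_le_add b2 b3) (show 0 ≤ z ^ (2 * k) by positivity)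
      push_cast
      linarith
    calc _ = (-th ρ α q) * (WW ρ S q * Z' q) := by ring
      _ ≤ (-th ρ α q) * (WW ρ S q * (ζ q ^ (2 * k) * (((2 * k + 2) * C + 1) *
        (‖h q‖ ^ 2 + ‖dd (adir α) h q‖ ^ 2)))) := by gcongr
      _ ≤ (Real.pi * rr ρ α) * (WW ρ S q * (ζ q ^ (2 * k) * (((2 * k + 2) * C + 1) *
        (‖h q‖ ^ 2 + ‖dd (adir α) h q‖ ^ 2)))) := by gcongr
      _ = _ := by rw [hc]; ring
  have hIneq := integral_mono i3.neg ((iA.add iB).const_mul c) key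
  rw [integral_const_mul, integral_add' iA iB] at hIneq
  have e1 : Jw ρ (insert α S) ζ (k+1) h = ∫ q, wt ρ α q * (WW ρ S q * Z q) := by
    unfold Jw
    congr 1
    funext q
    simp only [Z, WW, Finset.prod_insert hα, inner_smul_right, real_inner_self_eq_norm_sq]
    ring
  rw [e1]
  have e2 : ∫ q, -(fun q => th ρ α q * (WW ρ S q * Z' q)) q
    = -∫ q, th ρ α q * (WW ρ S q * Z' q) := integral_neg _
  simp only [Pi.neg_apply] at hIneq
  rw [e2] at hIneq
  change _ ≤ c * (Jw ρ S ζ k h + Jw ρ S ζ k (dd (adir α) h)) at hIneq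
  linarith

theorem sobS (hζ : Cut C Ω ζ) {ρ : ℝ} (hρ : 0 < ρ) {k : ℕ} (hk : k ≠ 0) {M : ℝ} (hM : 0 ≤ M)
    (S : Finset (Fin d)) : ∀ {h : ℝ × Ed d → Em m}, ContDiff ℝ (⊤ : ℕ∞) h →
    (∀ L : List (Fin d), L.length ≤ S.card → Jn ζ k (DL L h) ≤ M) →
    Jw ρ S ζ (k + S.card) h ≤
      (2 * (Real.pi * ((2 * (k + d) + 2) * C + 1))) ^ S.card * (∏ α ∈ S, rr ρ α) * M := by
  classical
  have hC := hζ.C_nonneg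
  induction S using Finset.induction_on with
  | empty =>
    intro h hh H
    have := H [] (by simp)
    simpa [Jw, Jn, WW, DL] using this
  | insert α S hα ih =>
    intro h hh H
    rw [Finset.card_insert_of_notMem hα] at *
    have h1 := sob1 hζ hρ (show k + S.card ≠ 0 by omega) hα hh
    have h2 := ih hh (fun L hL => H L (by omega))
    have h3 := ih (dd_smooth (adir α) hh) (fun L hL => by
      have := H (L ++ [α]) (by simp; omega)
      rwa [DL_append] at this)
    have hr := rr_pos hρ α
    have hS : (S.card : ℝ) ≤ d := by
      have := S.card_le_univ
      simp at this
      exact_mod_cast this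
    rw [← add_assoc]
    have hP : 0 ≤ ∏ α ∈ S, rr ρ α := Finset.prod_nonneg fun β _ => (rr_pos hρ β).le
    set P := ∏ α ∈ S, rr ρ α
    set c := Real.pi * ((2 * (k + d) + 2) * C + 1)
    have hpi := Real.pi_pos
    have hc : Real.pi * ((2 * ((k + S.card : ℕ):ℝ) + 2) * C + 1) ≤ c := by
      change _ ≤ Real.pi * ((2 * ((k:ℝ) + d) + 2) * C + 1)
      push_cast
      have : (S.card : ℝ) * C ≤ d * C := mul_le_mul_of_nonneg_right hS hC
      apply mul_le_mul_of_nonneg_left _ hpi.le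
      nlinarith
    have hc0 : 0 ≤ c := by positivity
    calc _ ≤ _ := h1
      _ ≤ Real.pi * ((2 * ((k + S.card : ℕ):ℝ) + 2) * C + 1) * rr ρ α *
        ((2 * c) ^ S.card * P * M + (2 * c) ^ S.card * P * M) := by
          gcongr
      _ ≤ c * rr ρ α *
        ((2 * c) ^ S.card * P * M + (2 * c) ^ S.card * P * M) := by
          gcongr
      _ = _ := by
          rw [Finset.prod_insert hα]
          ring

end iter

/-! ### Construction of cutoffs -/

section cutoff
variable {d : ℕ}

theorem sT_smooth : ContDiff ℝ (⊤ : ℕ∞) Real.smoothTransition :=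
  Real.smoothTransition.contDiff

theorem sT_deriv_nonneg (x : ℝ) : 0 ≤ deriv Real.smoothTransition x :=
  Real.smoothTransition.monotone.deriv_nonneg

theorem sT_deriv_bdd : ∃ C : ℝ, 0 ≤ C ∧ ∀ x, deriv Real.smoothTransition x ≤ C := by
  have hc : Continuous (deriv Real.smoothTransition) :=
    (sT_smooth.continuous_deriv (by simp))
  obtain ⟨C, hC⟩ := isCompact_Icc.exists_bound_of_continuousOn (s := Icc (0:ℝ) 1) hc.continuousOn
  have hC0 : 0 ≤ C := (norm_nonneg _).trans (hC 0 (by simp))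
  refine ⟨C, hC0, fun x => ?_⟩
  by_cases hx : x ∈ Icc (0:ℝ) 1
  · exact (le_abs_self _).trans (hC x hx)
  · have hx' : x < 0 ∨ 1 < x := by
      by_contra h; push Not at h; exact hx ⟨h.1, h.2⟩
    rcases hx' with h | h
    · have : Real.smoothTransition =ᶠ[nhds x] fun _ => 0 := by
        filter_upwards [Iio_mem_nhds h] with y hy
        exact Real.smoothTransition.zero_of_nonpos (le_of_lt hy)
      rw [this.deriv_eq]; simpa using hC0
    · have : Real.smoothTransition =ᶠ[nhds x] fun _ => 1 := by
        filter_upwards [Ioi_mem_nhds h] with y hy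
        exact Real.smoothTransition.one_of_one_le (le_of_lt hy)
      rw [this.deriv_eq]; simpa using hC0

theorem exists_cut (d : ℕ) : ∃ C : ℝ, ∀ τ : ℝ, 0 < τ → τ < 1 →
    ∃ ζ : ℝ × Ed d → ℝ, Cut C (Qc0 1) ζ ∧
      ∀ q : ℝ × Ed d, -(1/4) ≤ q.1 → q.1 ≤ -τ/2 → ‖q.2‖ ≤ 1/2 → ζ q = 1 := by
  obtain ⟨C1, hC1, H1⟩ := sT_deriv_bdd
  let ψ : ContDiffBump (0 : Ed d) := ⟨1/2, 3/4, by norm_num, by norm_num⟩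
  have hψ : ContDiff ℝ (⊤ : ℕ∞) (ψ : Ed d → ℝ) := ψ.contDiff
  have hψc : Continuous (fderiv ℝ (ψ : Ed d → ℝ)) := hψ.continuous_fderiv (by simp)
  obtain ⟨C2, hC2⟩ := (ψ.hasCompactSupport.fderiv (𝕜 := ℝ)).exists_bound_of_continuous hψc
  refine ⟨max (4 * C1) C2, fun τ hτ hτ1 => ?_⟩
  set χ : ℝ → ℝ := fun t => Real.smoothTransition (4 * t + 2) *
    Real.smoothTransition (-(4/τ) * t - 1) with hχ
  have a1 : ∀ t, HasDerivAt (fun t : ℝ => Real.smoothTransition (4 * t + 2))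
      (deriv Real.smoothTransition (4 * t + 2) * 4) t := by
    intro t
    have h1 : HasDerivAt (fun t : ℝ => 4 * t + 2) 4 t := by
      simpa using ((hasDerivAt_id t).const_mul (4:ℝ)).add_const (2:ℝ)
    exact ((sT_smooth.differentiable (by simp)) _).hasDerivAt.comp t h1
  have a2 : ∀ t, HasDerivAt (fun t : ℝ => Real.smoothTransition (-(4/τ) * t - 1))
      (deriv Real.smoothTransition (-(4/τ) * t - 1) * (-(4/τ))) t := by
    intro t
    have h1 : HasDerivAt (fun t : ℝ => -(4/τ) * t - 1) (-(4/τ)) t := by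
      simpa using ((hasDerivAt_id t).const_mul (-(4/τ):ℝ)).sub_const (1:ℝ)
    exact ((sT_smooth.differentiable (by simp)) _).hasDerivAt.comp t h1
  have hχs : ContDiff ℝ (⊤ : ℕ∞) χ := by
    refine (sT_smooth.comp ?_).mul (sT_smooth.comp ?_) <;> fun_prop
  have hχd : ∀ t, deriv χ t ≤ 4 * C1 := by
    intro t
    rw [show deriv χ t = _ from ((a1 t).fun_mul (a2 t)).deriv]
    have n1 := Real.smoothTransition.nonneg (4 * t + 2)
    have n2 := Real.smoothTransition.nonneg (-(4/τ) * t - 1)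
    have n3 := Real.smoothTransition.le_one (-(4/τ) * t - 1)
    have n4 := sT_deriv_nonneg (4 * t + 2)
    have n5 := sT_deriv_nonneg (-(4/τ) * t - 1)
    have n6 := H1 (4 * t + 2)
    have n7 : 0 < 4/τ := by positivity
    have n8 := mul_nonneg (mul_nonneg n1 n5) n7.le
    have n9 := mul_le_mul n6 n3 n2 hC1
    linarith
  have hχ0 : ∀ t, 0 ≤ χ t := fun t =>
    mul_nonneg (Real.smoothTransition.nonneg _) (Real.smoothTransition.nonneg _)
  have hχ1 : ∀ t, χ t ≤ 1 := fun t =>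
    mul_le_one₀ (Real.smoothTransition.le_one _) (Real.smoothTransition.nonneg _)
      (Real.smoothTransition.le_one _)
  have sf : ContDiff ℝ (⊤ : ℕ∞) (fun q : ℝ × Ed d => χ q.1) := hχs.comp contDiff_fst
  have sg : ContDiff ℝ (⊤ : ℕ∞) (fun q : ℝ × Ed d => ψ q.2) := hψ.comp contDiff_snd
  have df : ∀ (e q : ℝ × Ed d), dd e (fun q : ℝ × Ed d => χ q.1) q = e.1 * deriv χ q.1 := by
    intro e q
    have h := ((hχs.differentiable (by simp)) q.1).hasDerivAt.hasFDerivAt.comp q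
      (hasFDerivAt_fst (𝕜 := ℝ) (p := q))
    unfold dd
    change fderiv ℝ (χ ∘ Prod.fst) q e = _
    rw [h.fderiv]
    simp
  have dg : ∀ (e q : ℝ × Ed d), dd e (fun q : ℝ × Ed d => ψ q.2) q
      = fderiv ℝ (ψ : Ed d → ℝ) q.2 e.2 := by
    intro e q
    have h := ((hψ.differentiable (by simp)) q.2).hasFDerivAt.comp q
      (hasFDerivAt_snd (𝕜 := ℝ) (p := q))
    unfold dd
    change fderiv ℝ ((ψ : Ed d → ℝ) ∘ Prod.snd) q e = _
    rw [h.fderiv]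
    simp
  have hts : tsupport (fun q : ℝ × Ed d => χ q.1 • ψ q.2) ⊆
      Icc (-(1/2)) (-τ/4) ×ˢ closedBall 0 (3/4) := by
    refine closure_minimal ?_ (isClosed_Icc.prod isClosed_closedBall)
    intro q hq
    rw [mem_support, smul_eq_mul] at hq
    have h1 := left_ne_zero_of_mul hq
    have h2 := right_ne_zero_of_mul hq
    refine ⟨⟨?_, ?_⟩, ?_⟩
    · by_contra h
      push Not at h
      apply left_ne_zero_of_mul h1
      exact Real.smoothTransition.zero_of_nonpos (by linarith)
    · by_contra h
      push Not at h
      apply right_ne_zero_of_mul h1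
      apply Real.smoothTransition.zero_of_nonpos
      have : 4 / τ * (-τ/4) ≤ 4 / τ * q.1 := by gcongr
      have e : 4 / τ * (-τ/4) = -1 := by field_simp
      linarith
    · by_contra h
      apply h2
      apply ψ.zero_of_le_dist
      simp only [mem_closedBall, not_le] at h
      exact h.le
  refine ⟨fun q => χ q.1 • ψ q.2, ⟨?_, ?_, ?_, ?_, ?_, ?_, ?_⟩, ?_⟩
  · exact sf.smul sg
  · exact HasCompactSupport.of_support_subset_isCompact
      (isCompact_Icc.prod (isCompact_closedBall _ _)) ((subset_tsupport _).trans hts)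
  · refine hts.trans ?_
    rintro ⟨t, x⟩ ⟨⟨h1, h2⟩, h3⟩
    simp only [Qc0, Qc, mem_prod, mem_Ioo, mem_ball] at *
    simp only [mem_closedBall] at h3
    refine ⟨⟨by linarith, by linarith⟩, by linarith⟩
  · intro q
    exact mul_nonneg (hχ0 _) ψ.nonneg
  · intro q
    exact mul_le_one₀ (hχ1 _) ψ.nonneg ψ.le_one
  · intro α q
    rw [pd_eq_dd, dd_mul _ sf sg, df, dg]
    simp only [zero_mul, zero_smul, add_zero, smul_eq_mul, abs_mul]
    refine le_trans ?_ (le_max_right _ _)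
    have h1 : |χ q.1| ≤ 1 := by rw [abs_of_nonneg (hχ0 _)]; exact hχ1 _
    have h2 : |fderiv ℝ (ψ : Ed d → ℝ) q.2 (EuclideanSpace.single α 1)| ≤ C2 := by
      refine ((fderiv ℝ (ψ : Ed d → ℝ) q.2).le_opNorm _).trans ?_
      simpa using hC2 q.2
    have := mul_le_mul h1 h2 (abs_nonneg _) zero_le_one
    linarith
  · intro q
    rw [pt_eq_dd, dd_mul _ sf sg, df, dg]
    simp only [map_zero, smul_zero, zero_add, one_mul, smul_eq_mul]
    refine le_trans ?_ (le_max_left _ _)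
    have h1 : (0:ℝ) ≤ ψ q.2 := ψ.nonneg
    have h2 : ψ q.2 ≤ 1 := ψ.le_one
    have h3 := hχd q.1
    have h4 : deriv χ q.1 * ψ q.2 ≤ 4 * C1 * ψ q.2 := by gcongr
    have h5 : 4 * C1 * ψ q.2 ≤ 4 * C1 * 1 := by gcongr
    linarith
  · intro q h1 h2 h3
    have e1 : ψ q.2 = 1 := ψ.one_of_mem_closedBall (by simpa [ψ] using h3)
    have e2 : χ q.1 = 1 := by
      simp only [hχ]
      rw [Real.smoothTransition.one_of_one_le (by linarith), Real.smoothTransition.one_of_one_le,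
        one_mul]
      have : 4 / τ * q.1 ≤ 4 / τ * (-τ/2) := by gcongr
      have e : 4 / τ * (-τ/2) = -2 := by field_simp; norm_num
      linarith
    simp [e1, e2]

end cutoff

/-! ### Local bounds -/

/-- The intermediate cylinder. -/
def Qm {d : ℕ} (a b s : ℝ) : Set (ℝ × Ed d) := Ioo (-a) (-b) ×ˢ ball 0 s

section local_bounds
variable {d m : ℕ} [NeZero d] {δ : ℝ}

theorem Qm_open (a b s : ℝ) : IsOpen (Qm a b s : Set (ℝ × Ed d)) := isOpen_Ioo.prod isOpen_ball

theorem Qm_meas (a b s : ℝ) : MeasurableSet (Qm a b s : Set (ℝ × Ed d)) := (Qm_open a b s).measurableSet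

theorem Qm_sub_cpt (a b s : ℝ) :
    (Qm a b s : Set (ℝ × Ed d)) ⊆ Icc (-a) (-b) ×ˢ closedBall 0 s :=
  prod_mono Ioo_subset_Icc_self ball_subset_closedBall

theorem Qm_int {E : Type*} [NormedAddCommGroup E] {f : ℝ × Ed d → E} (hf : Continuous f)
    (a b s : ℝ) : IntegrableOn f (Qm a b s) :=
  (hf.continuousOn.integrableOn_compact
    (isCompact_Icc.prod (isCompact_closedBall _ _))).mono_set (Qm_sub_cpt a b s)

theorem Qc0_eq (r : ℝ) : (Qc0 r : Set (ℝ × Ed d)) = Qm (r ^ 2) 0 r := by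
  simp [Qc0, Qc, Qm]

theorem rr_prod (ρ : ℝ) : ∏ α : Fin d, rr ρ α = ρ ^ (d + 1) := by
  rw [← Finset.mul_prod_erase Finset.univ _ (Finset.mem_univ (0 : Fin d))]
  rw [Finset.prod_congr rfl (g := fun _ => ρ) (fun α hα => by
    simp [rr, (Finset.mem_erase.1 hα).1])]
  simp only [Finset.prod_const, Finset.card_erase_of_mem (Finset.mem_univ _), Finset.card_univ,
    Fintype.card_fin, rr, if_true]
  rw [← pow_add]
  congr 1
  have := NeZero.ne d
  omega

theorem WW_lower {ρ : ℝ} (hρ : 0 < ρ) {q : ℝ × Ed d} (h1 : -(4 * ρ ^ 2) < q.1) (h2 : q.1 < 0)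
    (h3 : ‖q.2‖ < 2 * ρ) : (1/17 : ℝ) ^ d ≤ WW ρ Finset.univ q := by
  have key : ∀ α : Fin d, (1/17 : ℝ) ≤ wt ρ α q := by
    intro α
    unfold wt
    have hr := rr_pos hρ α
    have : |cc α q / rr ρ α| ≤ 4 := by
      rw [abs_div, abs_of_pos hr, div_le_iff₀ hr]
      unfold cc rr
      split_ifs
      · rw [abs_of_neg h2]; linarith
      · have := PiLp.norm_apply_le q.2 α
        rw [Real.norm_eq_abs] at this
        linarith
    have h4 : (cc α q / rr ρ α) ^ 2 ≤ 16 := by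
      rw [← sq_abs]; nlinarith [abs_nonneg (cc α q / rr ρ α)]
    apply one_div_le_one_div_of_le (by positivity)
    linarith
  calc (1/17 : ℝ) ^ d = ∏ α : Fin d, (1/17 : ℝ) := by simp
    _ ≤ _ := Finset.prod_le_prod (fun _ _ => by norm_num) (fun α _ => key α)

theorem L2bd (hδ : 0 < δ) : ∃ N : ℝ, 0 ≤ N ∧ ∀ ρ τ : ℝ, 0 < ρ → ρ ≤ 1/4 → 0 < τ → τ < 1 →
    ∀ (A : Fin d → Fin d → ℝ → CLM m) (u : ℝ × Ed d → Em m), CoeffsOne δ A →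
    ContDiff ℝ (⊤ : ℕ∞) u → WS A (Qc0 1) u →
    ((∀ α β, ∫ q in Qm (4 * ρ ^ 2) (τ / 2) (2 * ρ), ‖pd β (dd (adir α) u) q‖ ^ 2
      ≤ N * ρ ^ (d + 1) * ∫ q in Qc0 1, gradSq u q) ∧
    ∫ q in Qm (4 * ρ ^ 2) (τ / 2) (2 * ρ), ‖pt u q‖ ^ 2
      ≤ N * ρ ^ (d + 1) * ∫ q in Qc0 1, gradSq u q) := by
  obtain ⟨C, hC⟩ := exists_cut d
  obtain ⟨N, hN, H⟩ := iter_J (d := d) (m := m) hδ C d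
  set k := 2 * d + 3 with hk
  set P : ℝ := (2 * (Real.pi * ((2 * ((k:ℝ) + d) + 2) * C + 1))) ^ d with hP
  have hC0 : 0 ≤ C := by
    obtain ⟨ζ, hζ, -⟩ := hC (1/2) (by norm_num) (by norm_num)
    exact hζ.C_nonneg
  have hP0 : 0 ≤ P := by have := Real.pi_pos; positivity
  refine ⟨17 ^ d * P * N, by positivity, fun ρ τ hρ hρ4 hτ hτ1 A u hA hu hw => ?_⟩
  obtain ⟨ζ, hζ, hζ1⟩ := hC τ hτ hτ1
  have hE0 := En_nonneg hζ 1 u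
  have hE : En ζ 1 u ≤ ∫ q in Qc0 1, gradSq u q := by
    unfold En
    have hs : ∀ q, q ∉ (Qc0 1 : Set (ℝ × Ed d)) → ζ q ^ (2 * 1) * gradSq u q = 0 := by
      intro q hq
      rw [hζ.zero (fun h => hq (hζ.sub h))]
      simp
    rw [← setIntegral_eq_integral_of_forall_compl_eq_zero hs]
    rw [Qc0_eq]
    refine setIntegral_mono (hζ.int (by norm_num) (gradSq_cont hu)).integrableOn
      (Qm_int (gradSq_cont hu) _ _ _) fun q => ?_
    have h1 := hζ.nn q
    have h2 := hζ.le1 q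
    have h3 : ζ q ^ (2 * 1) ≤ 1 := pow_le_one₀ h1 h2
    have := mul_le_mul_of_nonneg_right h3 (gradSq_nonneg u q)
    linarith
  have main : ∀ h : ℝ × Ed d → Em m, ContDiff ℝ (⊤ : ℕ∞) h →
      (∀ L : List (Fin d), L.length ≤ d → Jn ζ k (DL L h) ≤ N * En ζ 1 u) →
      ∫ q in Qm (4 * ρ ^ 2) (τ / 2) (2 * ρ), ‖h q‖ ^ 2
      ≤ 17 ^ d * P * N * ρ ^ (d + 1) * ∫ q in Qc0 1, gradSq u q := by
    intro h hh hL
    have h1 := sobS hζ hρ (show k ≠ 0 by omega) (show 0 ≤ N * En ζ 1 u by positivity)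
      Finset.univ hh (fun L hl => hL L (by simpa using hl))
    rw [rr_prod, Finset.card_univ, Fintype.card_fin] at h1
    have hch := hh.continuous
    have hcW := WW_cont (d := d) ρ Finset.univ
    have iJ : Integrable (fun q => ζ q ^ (2 * (k + d)) * (WW ρ Finset.univ q * ‖h q‖ ^ 2)) :=
      hζ.int (by omega) (by fun_prop)
    have h2 : ∫ q in Qm (4 * ρ ^ 2) (τ / 2) (2 * ρ), ‖h q‖ ^ 2
        ≤ 17 ^ d * Jw ρ Finset.univ ζ (k + d) h := by
      have e : Jw ρ Finset.univ ζ (k + d) h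
        = ∫ q, ζ q ^ (2 * (k + d)) * (WW ρ Finset.univ q * ‖h q‖ ^ 2) := by
        rfl
      rw [e, ← integral_const_mul]
      refine le_trans ?_ (setIntegral_le_integral (s := Qm (4 * ρ ^ 2) (τ / 2) (2 * ρ))
        (iJ.const_mul _) (Filter.Eventually.of_forall fun q => ?_))
      · refine setIntegral_mono_on (Qm_int (by fun_prop) _ _ _) (iJ.const_mul _).integrableOn
          (Qm_meas _ _ _) fun q hq => ?_
        obtain ⟨⟨q1, q2⟩, q3⟩ := hq
        rw [mem_ball_zero_iff] at q3
        have z1 : ζ q = 1 := hζ1 q (by nlinarith) (by linarith) (by linarith)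
        have w1 := WW_lower hρ q1 (by linarith) q3
        rw [z1, one_pow, one_mul, ← mul_assoc]
        have : (1:ℝ) ≤ 17 ^ d * WW ρ Finset.univ q := by
          calc (1:ℝ) = 17 ^ d * (1/17) ^ d := by rw [← mul_pow]; norm_num
            _ ≤ _ := by gcongr
        have := mul_le_mul_of_nonneg_right this (sq_nonneg ‖h q‖)
        linarith
      · have := hζ.nn q
        have := WW_pos ρ Finset.univ q
        simp only [Pi.zero_apply]
        positivity
    calc _ ≤ _ := h2
      _ ≤ 17 ^ d * (P * ρ ^ (d + 1) * (N * ∫ q in Qc0 1, gradSq u q)) := by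
        gcongr
        refine h1.trans ?_
        gcongr
      _ = _ := by ring
  refine ⟨fun α β => main _ (pd_smooth β (dd_smooth _ hu)) fun L hL =>
    (H A _ ζ u hA hζ hu hw L hL).1 α β, main _ (dd_smooth _ hu) fun L hL =>
    (H A _ ζ u hA hζ hu hw L hL).2⟩

end local_bounds

/-! ### A Poincare inequality on convex sets -/

section poincare

theorem lint_scale {E : Type*} [NormedAddCommGroup E] [NormedSpace ℝ E] [FiniteDimensional ℝ E]
    [MeasurableSpace E] [BorelSpace E] (μ : Measure E) [μ.IsAddHaarMeasure]
    {G : E → ℝ≥0∞} (hG : Measurable G) {s : ℝ} (hs : 1/2 ≤ s) (v : E) :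
    ∫⁻ q, G (s • q + v) ∂μ ≤ 2 ^ (Module.finrank ℝ E) * ∫⁻ q, G q ∂μ := by
  have hs0 : s ≠ 0 := by intro h; rw [h] at hs; norm_num at hs
  have h1 : ∫⁻ q, G (s • q + v) ∂μ = ∫⁻ q, G (q + v) ∂(Measure.map (s • ·) μ) := by
    exact (lintegral_map (f := fun q => G (q + v)) (hG.comp (measurable_add_const v))
      (measurable_const_smul s)).symm
  rw [h1, Measure.map_addHaar_smul μ hs0, lintegral_smul_measure, lintegral_add_right_eq_self]
  rw [smul_eq_mul]
  gcongr
  rw [ENNReal.ofReal_le_iff_le_toReal (by finiteness)]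
  rw [abs_of_nonneg (by positivity)]
  simp only [ENNReal.toReal_pow, ENNReal.toReal_ofNat]
  rw [← inv_pow]
  gcongr
  rw [inv_le_comm₀ (by positivity) (by norm_num)]
  linarith

theorem poin_half {E : Type*} [NormedAddCommGroup E] [NormedSpace ℝ E] [FiniteDimensional ℝ E]
    [MeasurableSpace E] [BorelSpace E] (μ : Measure E) [μ.IsAddHaarMeasure]
    {G : E → ℝ≥0∞} (hG : Measurable G) (Q : Set E) {S : Set ℝ} (hS : MeasurableSet S)
    (w : ℝ → ℝ) (hw : Continuous w)
    (hS1 : ∀ s ∈ S, 1/2 ≤ w s) :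
    ∫⁻ p in Q, ∫⁻ q in Q, ∫⁻ s in S, G (w s • q + (1 - w s) • p) ∂volume ∂μ ∂μ
      ≤ (2 ^ (Module.finrank ℝ E) * ∫⁻ q, G q ∂μ) * volume S * μ Q := by
  calc _ ≤ ∫⁻ p in Q, (2 ^ (Module.finrank ℝ E) * ∫⁻ q, G q ∂μ) * volume S ∂μ := by
        gcongr with p
        rw [lintegral_lintegral_swap]
        · calc _ ≤ ∫⁻ s in S, (2 ^ (Module.finrank ℝ E) * ∫⁻ q, G q ∂μ) := by
                refine setLIntegral_mono' hS fun s hs => ?_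
                refine (lintegral_mono' Measure.restrict_le_self le_rfl).trans ?_
                exact lint_scale μ hG (hS1 s hs) _
            _ = _ := by rw [setLIntegral_const]
        · refine Measurable.aemeasurable ?_
          refine hG.comp (Continuous.measurable ?_)
          fun_prop
    _ = _ := by rw [setLIntegral_const]

theorem poin_double {E : Type*} [NormedAddCommGroup E] [NormedSpace ℝ E] [FiniteDimensional ℝ E]
    [MeasurableSpace E] [BorelSpace E] (μ : Measure E) [μ.IsAddHaarMeasure]
    {G : E → ℝ≥0∞} (hG : Measurable G) (Q : Set E) :
    ∫⁻ p in Q, ∫⁻ q in Q, ∫⁻ s in Ioc (0:ℝ) 1, G (q + s • (p - q)) ∂volume ∂μ ∂μ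
      ≤ (2 ^ (Module.finrank ℝ E) * ∫⁻ q, G q ∂μ) * μ Q := by
  set K := 2 ^ (Module.finrank ℝ E) * ∫⁻ q, G q ∂μ
  have m1 : ∀ S : Set ℝ, Measurable (fun x : E × E => ∫⁻ s in S, G (x.2 + s • (x.1 - x.2))) := by
    intro S
    refine Measurable.lintegral_prod_right (f := fun (x : E × E) (s : ℝ) =>
      G (x.2 + s • (x.1 - x.2))) ?_
    refine hG.comp (Continuous.measurable ?_)
    fun_prop
  have hU : Ioc (0:ℝ) 1 = Ioc 0 (1/2) ∪ Ioc (1/2) 1 :=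
    (Ioc_union_Ioc_eq_Ioc (by norm_num) (by norm_num)).symm
  have hd : Disjoint (Ioc (0:ℝ) (1/2)) (Ioc (1/2) 1) := Ioc_disjoint_Ioc_of_le le_rfl
  have v1 : volume (Ioc (0:ℝ) (1/2)) = 2⁻¹ := by
    rw [Real.volume_Ioc, sub_zero, one_div, ENNReal.ofReal_inv_of_pos (by norm_num)]; simp
  have v2 : volume (Ioc (1/2:ℝ) 1) = 2⁻¹ := by
    rw [Real.volume_Ioc, show (1:ℝ) - 1/2 = 2⁻¹ by norm_num,
      ENNReal.ofReal_inv_of_pos (by norm_num)]; simp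
  have h1 := poin_half μ hG Q (S := Ioc (0:ℝ) (1/2)) measurableSet_Ioc (fun s => 1 - s)
    (by fun_prop) (fun s hs => by linarith [hs.2])
  have h2 := poin_half μ hG Q (S := Ioc (1/2:ℝ) 1) measurableSet_Ioc (fun s => s)
    (by fun_prop) (fun s hs => hs.1.le)
  rw [v1] at h1
  rw [v2] at h2
  have e1 : ∀ (p q : E) (s : ℝ), (1 - s) • q + (1 - (1 - s)) • p = q + s • (p - q) := by
    intro p q s; module
  have e2 : ∀ (p q : E) (s : ℝ), s • q + (1 - s) • p = p + s • (q - p) := by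
    intro p q s; module
  simp only [e1] at h1
  simp only [e2] at h2
  rw [lintegral_lintegral_swap (f := fun p q => ∫⁻ s in Ioc (1/2:ℝ) 1, G (p + s • (q - p)))
    ((m1 _).comp measurable_swap).aemeasurable] at h2
  have m2 : ∀ (S : Set ℝ) (p : E), Measurable (fun q : E => ∫⁻ s in S, G (q + s • (p - q))) :=
    fun S p => (m1 S).comp measurable_prodMk_left
  have m3 : ∀ (S : Set ℝ),
      Measurable (fun p : E => ∫⁻ q in Q, ∫⁻ s in S, G (q + s • (p - q)) ∂volume ∂μ) :=
    fun S => Measurable.lintegral_prod_right (m1 S)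
  have e3 : ∀ p q : E, ∫⁻ s in Ioc (0:ℝ) 1, G (q + s • (p - q)) =
      (∫⁻ s in Ioc (0:ℝ) (1/2), G (q + s • (p - q))) +
        ∫⁻ s in Ioc (1/2:ℝ) 1, G (q + s • (p - q)) := by
    intro p q
    rw [hU, lintegral_union measurableSet_Ioc hd]
  simp only [e3]
  simp only [lintegral_add_left (m2 _ _)]
  rw [lintegral_add_left (m3 _)]
  refine (add_le_add h1 h2).trans ?_
  rw [← add_mul, ← mul_add, ENNReal.inv_two_add_inv_two, mul_one]

variable {d m : ℕ}

theorem dir_decomp (v : ℝ × Ed d) :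
    v = v.1 • ((1, 0) : ℝ × Ed d) + ∑ i, v.2 i • ((0, EuclideanSpace.single i 1) : ℝ × Ed d) := by
  ext i
  · simp [Prod.fst_sum]
  · simp [Prod.snd_sum, Pi.single_apply]

theorem poin_smooth {f : ℝ × Ed d → Em m} (hf : ContDiff ℝ (⊤ : ℕ∞) f) {Q : Set (ℝ × Ed d)}
    (hQ : Convex ℝ Q) (hQm : MeasurableSet Q) {c : ℝ}
    (hc1 : ∀ p ∈ Q, ∀ q ∈ Q, |p.1 - q.1| ≤ c)
    (hc2 : ∀ p ∈ Q, ∀ q ∈ Q, ∀ i, |p.2 i - q.2 i| ≤ c) :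
    ∫⁻ p in Q, ∫⁻ q in Q, ‖f p - f q‖ₑ ≤
      (2 ^ (d + 1) * ∫⁻ q in Q, ENNReal.ofReal c * (‖pt f q‖ₑ + ∑ i, ‖pd i f q‖ₑ)) * volume Q := by
  set g : ℝ × Ed d → ℝ≥0∞ := fun q => ENNReal.ofReal c * (‖pt f q‖ₑ + ∑ i, ‖pd i f q‖ₑ) with hg
  have hgm : Measurable g := by
    have h1 : Measurable (fun q => ‖pt f q‖ₑ) := (dd_smooth (1,0) hf).continuous.enorm.measurable
    have h2 : ∀ i, Measurable (fun q => ‖pd i f q‖ₑ) :=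
      fun i => (pd_smooth i hf).continuous.enorm.measurable
    exact (h1.add (Finset.measurable_sum _ fun i _ => h2 i)).const_mul _
  have hG : Measurable (Q.indicator g) := hgm.indicator hQm
  have h := poin_double volume hG Q
  have hr : Module.finrank ℝ (ℝ × Ed d) = d + 1 := by
    simp [Module.finrank_prod, add_comm]
  rw [hr, lintegral_indicator hQm] at h
  refine le_trans ?_ h
  refine setLIntegral_mono' hQm fun p hp => setLIntegral_mono' hQm fun q hq => ?_
  have hd : ∀ s : ℝ, HasDerivAt (fun s : ℝ => f (q + s • (p - q)))
      (fderiv ℝ f (q + s • (p - q)) (p - q)) s := by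
    intro s
    have h1 : HasDerivAt (fun s : ℝ => q + s • (p - q)) (p - q) s := by
      simpa using ((hasDerivAt_id s).smul_const (p - q)).const_add q
    exact ((hf.differentiable (by simp)) _).hasFDerivAt.comp_hasDerivAt s h1
  have hcd : Continuous (fun s : ℝ => fderiv ℝ f (q + s • (p - q)) (p - q)) := by
    have := hf.continuous_fderiv (by simp)
    fun_prop
  have hft := intervalIntegral.integral_eq_sub_of_hasDerivAt (a := 0) (b := 1)
    (fun s _ => hd s) (hcd.intervalIntegrable _ _)
  simp only [one_smul, zero_smul, add_zero, add_sub_cancel] at hft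
  rw [← hft, intervalIntegral.integral_of_le zero_le_one]
  refine (enorm_integral_le_lintegral_enorm _).trans ?_
  refine setLIntegral_mono' measurableSet_Ioc fun s hs => ?_
  have hz : q + s • (p - q) ∈ Q := hQ.add_smul_sub_mem hq hp ⟨hs.1.le, hs.2⟩
  rw [indicator_of_mem hz]
  set z := q + s • (p - q)
  conv_lhs => rw [dir_decomp (p - q), map_add, map_sum]
  simp only [map_smul]
  change ‖(p - q).1 • pt f z + ∑ i, (p - q).2 i • pd i f z‖ₑ ≤ _
  have hcE : ∀ x : ℝ, |x| ≤ c → ‖x‖ₑ ≤ ENNReal.ofReal c := by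
    intro x hx
    rw [← ofReal_norm]
    exact ENNReal.ofReal_le_ofReal hx
  calc _ ≤ ‖(p - q).1 • pt f z‖ₑ + ∑ i, ‖(p - q).2 i • pd i f z‖ₑ :=
        (enorm_add_le _ _).trans (add_le_add le_rfl (enorm_sum_le _ _))
    _ ≤ ENNReal.ofReal c * ‖pt f z‖ₑ + ∑ i, ENNReal.ofReal c * ‖pd i f z‖ₑ := by
        simp only [enorm_smul]
        gcongr with i
        · exact hcE _ (hc1 p hp q hq)
        · exact hcE _ (hc2 p hp q hq i)
    _ = _ := by rw [hg]; simp only [mul_add, Finset.mul_sum]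

end poincare

/-! ### Mollification -/

section molly
open scoped Convolution
open ContinuousLinearMap (lsmul)
variable {d m : ℕ}

/-- Weak directional derivatives. -/
def WD (Ω : Set (ℝ × Ed d)) (e : ℝ × Ed d) (F G : ℝ × Ed d → Em m) : Prop :=
  ∀ η : ℝ × Ed d → ℝ, ContDiff ℝ (⊤ : ℕ∞) η → HasCompactSupport η → tsupport η ⊆ Ω →
    ∫ q, dd e η q • F q = -∫ q, η q • G q

/-- mollification -/
def mol (φ : ContDiffBump (0 : ℝ × Ed d)) (F : ℝ × Ed d → Em m) : ℝ × Ed d → Em m :=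
  (φ.normed volume) ⋆[lsmul ℝ ℝ, volume] F

theorem mol_smooth (φ : ContDiffBump (0 : ℝ × Ed d)) {F : ℝ × Ed d → Em m}
    (hF : LocallyIntegrable F) : ContDiff ℝ (⊤ : ℕ∞) (mol φ F) :=
  φ.hasCompactSupport_normed.contDiff_convolution_left _ φ.contDiff_normed hF

theorem mol_dd (φ : ContDiffBump (0 : ℝ × Ed d)) {F G : ℝ × Ed d → Em m}
    (hF : LocallyIntegrable F) {Ω : Set (ℝ × Ed d)} {e : ℝ × Ed d} (h : WD Ω e F G)
    {p : ℝ × Ed d} (hp : closedBall p φ.rOut ⊆ Ω) : dd e (mol φ F) p = mol φ G p := by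
  set f := φ.normed (volume : Measure (ℝ × Ed d)) with hf
  have hfs : ContDiff ℝ (⊤ : ℕ∞) f := φ.contDiff_normed
  have hcf : HasCompactSupport f := φ.hasCompactSupport_normed
  have h1 := hcf.hasFDerivAt_convolution_left (lsmul ℝ ℝ) (hfs.of_le (by simp)) hF p
  have hex : ConvolutionExistsAt (fderiv ℝ f) F p ((lsmul ℝ ℝ).precompL (ℝ × Ed d)) volume :=
    (hcf.fderiv (𝕜 := ℝ)).convolutionExists_left _ (hfs.continuous_fderiv (by simp)) hF p
  unfold dd
  change fderiv ℝ (f ⋆[lsmul ℝ ℝ, volume] F) p e = _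
  rw [h1.fderiv, convolution_eq_swap, ContinuousLinearMap.integral_apply hex.integrable_swap]
  have hη : ContDiff ℝ (⊤ : ℕ∞) (fun t => f (p - t)) := hfs.comp (by fun_prop)
  have hdη : ∀ t, dd e (fun t => f (p - t)) t = -(fderiv ℝ f (p - t) e) := by
    intro t
    have h2 : HasFDerivAt (fun t => f (p - t)) ((fderiv ℝ f (p - t)).comp
        (-ContinuousLinearMap.id ℝ (ℝ × Ed d))) t :=
      ((hfs.differentiable (by simp)) _).hasFDerivAt.comp t ((hasFDerivAt_id t).const_sub p)
    unfold dd
    rw [h2.fderiv]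
    simp
  have hηc : HasCompactSupport (fun t => f (p - t)) := hcf.comp_homeomorph (Homeomorph.subLeft p)
  have hηs : tsupport (fun t => f (p - t)) ⊆ Ω := by
    refine subset_trans ?_ hp
    refine closure_minimal ?_ isClosed_closedBall
    intro t ht
    have : p - t ∈ support f := ht
    rw [hf, φ.support_normed_eq, mem_ball_zero_iff] at this
    rw [mem_closedBall, dist_eq_norm, ← norm_neg, neg_sub]
    exact this.le
  have := h _ hη hηc hηs
  simp only [hdη, neg_smul, integral_neg, neg_inj] at this
  have e1 : mol φ G p = ∫ q, f (p - q) • G q := by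
    unfold mol; rw [convolution_eq_swap]; rfl
  rw [e1, ← this]
  rfl

theorem mol_le (φ : ContDiffBump (0 : ℝ × Ed d)) {G : ℝ × Ed d → Em m} {H : ℝ × Ed d → ℝ≥0∞}
    (hH : Measurable H) (hGH : ∀ q, ‖G q‖ₑ ≤ H q) {Q Q' : Set (ℝ × Ed d)} (hQ : MeasurableSet Q)
    (hQ' : MeasurableSet Q') (hs : ∀ p ∈ Q, closedBall p φ.rOut ⊆ Q') :
    ∫⁻ p in Q, ‖mol φ G p‖ₑ ≤ ∫⁻ p in Q', H p := by
  set f := φ.normed (volume : Measure (ℝ × Ed d)) with hf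
  have hfm : Measurable f := φ.continuous_normed.measurable
  have hHm : Measurable (Q'.indicator H) := hH.indicator hQ'
  calc _ ≤ ∫⁻ p in Q, ∫⁻ t, ‖f t‖ₑ * Q'.indicator H (p - t) := by
        refine setLIntegral_mono' hQ fun p hp => ?_
        unfold mol
        rw [convolution_def]
        refine (enorm_integral_le_lintegral_enorm _).trans ?_
        refine lintegral_mono fun t => ?_
        simp only [ContinuousLinearMap.lsmul_apply]
        rw [enorm_smul]
        by_cases ht : f t = 0
        · rw [← hf, ht]; simp
        · have h1 : t ∈ support f := ht
          rw [hf, φ.support_normed_eq, mem_ball_zero_iff] at h1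
          have h2 : p - t ∈ Q' := hs p hp (by
            rw [mem_closedBall, dist_eq_norm]; simpa using h1.le)
          rw [indicator_of_mem h2]
          gcongr
          exact hGH _
    _ ≤ ∫⁻ p, ∫⁻ t, ‖f t‖ₑ * Q'.indicator H (p - t) :=
        lintegral_mono' Measure.restrict_le_self le_rfl
    _ = ∫⁻ t, ∫⁻ p, ‖f t‖ₑ * Q'.indicator H (p - t) := by
        rw [lintegral_lintegral_swap]
        refine Measurable.aemeasurable ?_
        exact (hfm.comp measurable_snd).enorm.mul
          (hHm.comp (measurable_fst.sub measurable_snd))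
    _ = ∫⁻ t, ‖f t‖ₑ * ∫⁻ p in Q', H p := by
        refine lintegral_congr fun t => ?_
        rw [lintegral_const_mul (f := fun p => Q'.indicator H (p - t)) _
            (hHm.comp (measurable_id.sub_const t)),
          lintegral_sub_right_eq_self (Q'.indicator H) t, lintegral_indicator hQ']
    _ = (∫⁻ t, ‖f t‖ₑ) * ∫⁻ p in Q', H p := lintegral_mul_const _ hfm.enorm
    _ = _ := by
        have : ∫⁻ t, ‖f t‖ₑ = 1 := by
          have h1 : ∀ t, ‖f t‖ₑ = ENNReal.ofReal (f t) := fun t =>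
            Real.enorm_of_nonneg (φ.nonneg_normed t)
          simp only [h1]
          rw [← ofReal_integral_eq_lintegral_ofReal φ.integrable_normed
            (Filter.Eventually.of_forall φ.nonneg_normed), φ.integral_normed]
          simp
        rw [this, one_mul]

theorem poin_weak {F Gt : ℝ × Ed d → Em m} {Gx : Fin d → ℝ × Ed d → Em m}
    (hF : LocallyIntegrable F) {H : ℝ × Ed d → ℝ≥0∞} (hH : Measurable H)
    (ht : ∀ q, ‖Gt q‖ₑ ≤ H q) (hx : ∀ i q, ‖Gx i q‖ₑ ≤ H q)
    {Q Q' : Set (ℝ × Ed d)} (hQ : MeasurableSet Q) (hQ' : MeasurableSet Q') (hQc : Convex ℝ Q)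
    {ε : ℝ} (hε : 0 < ε) (hs : ∀ p ∈ Q, closedBall p ε ⊆ Q')
    (wt : WD Q' (1, 0) F Gt) (wx : ∀ i, WD Q' (0, EuclideanSpace.single i 1) F (Gx i))
    {c : ℝ} (hc1 : ∀ p ∈ Q, ∀ q ∈ Q, |p.1 - q.1| ≤ c)
    (hc2 : ∀ p ∈ Q, ∀ q ∈ Q, ∀ i, |p.2 i - q.2 i| ≤ c) :
    ∫⁻ p in Q, ∫⁻ q in Q, ‖F p - F q‖ₑ ≤
      2 ^ (d + 1) * (ENNReal.ofReal c * ((d + 1) * ∫⁻ q in Q', H q)) * volume Q := by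
  let φ : ℕ → ContDiffBump (0 : ℝ × Ed d) := fun n =>
    ⟨ε / 2 / (n + 1), ε / (n + 1), by positivity, by
      apply div_lt_div_of_pos_right _ (by positivity); linarith⟩
  have hr : ∀ n, (φ n).rOut ≤ ε := fun n => by
    change ε / (n + 1) ≤ ε
    apply div_le_self hε.le
    have : (0:ℝ) ≤ n := by positivity
    linarith
  have hlim : Filter.Tendsto (fun n => (φ n).rOut) Filter.atTop (nhds 0) := by
    change Filter.Tendsto (fun n : ℕ => ε / (n + 1)) Filter.atTop (nhds 0)
    have := (tendsto_one_div_add_atTop_nhds_zero_nat (𝕜 := ℝ)).const_mul ε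
    simpa [div_eq_mul_inv] using this
  have hae := ContDiffBump.ae_convolution_tendsto_right_of_locallyIntegrable (K := 2) hlim
    (Filter.Eventually.of_forall fun n => by
      change ε / (n + 1) ≤ 2 * (ε / 2 / (n + 1))
      apply le_of_eq; ring) hF
  have hae' : ∀ᵐ x ∂(volume.restrict Q),
      Filter.Tendsto (fun n => mol (φ n) F x) Filter.atTop (nhds (F x)) := ae_restrict_of_ae hae
  have cm : ∀ n, Continuous (mol (φ n) F) := fun n => (mol_smooth (φ n) hF).continuous
  have step1 : ∫⁻ p in Q, ∫⁻ q in Q, ‖F p - F q‖ₑ ≤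
      Filter.liminf (fun n => ∫⁻ p in Q, ∫⁻ q in Q, ‖mol (φ n) F p - mol (φ n) F q‖ₑ)
        Filter.atTop := by
    refine le_trans ?_ (lintegral_liminf_le fun n => ?_)
    · refine lintegral_mono_ae ?_
      filter_upwards [hae'] with p hp
      refine le_trans ?_ (lintegral_liminf_le fun n => ?_)
      · refine lintegral_mono_ae ?_
        filter_upwards [hae'] with q hq
        exact ((hp.sub hq).enorm).liminf_eq.ge
      · exact (continuous_const.sub (cm n)).enorm.measurable
    · refine Measurable.lintegral_prod_right (f := fun p q => ‖mol (φ n) F p - mol (φ n) F q‖ₑ) ?_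
      refine Continuous.measurable ?_
      have := cm n
      exact (((cm n).comp continuous_fst).sub ((cm n).comp continuous_snd)).enorm
  refine step1.trans ?_
  refine Filter.liminf_le_of_le (by isBoundedDefault) fun b hb => ?_
  obtain ⟨n, hn⟩ := hb.exists
  refine hn.trans ?_
  refine (poin_smooth (mol_smooth (φ n) hF) hQc hQ hc1 hc2).trans ?_
  have hs' : ∀ p ∈ Q, closedBall p (φ n).rOut ⊆ Q' := fun p hp =>
    (closedBall_subset_closedBall (hr n)).trans (hs p hp)
  gcongr
  have hm1 : Measurable fun q => ‖pt (mol (φ n) F) q‖ₑ :=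
    (dd_smooth (1,0) (mol_smooth (φ n) hF)).continuous.enorm.measurable
  have hm2 : ∀ i, Measurable fun q => ‖pd i (mol (φ n) F) q‖ₑ := fun i =>
    (pd_smooth i (mol_smooth (φ n) hF)).continuous.enorm.measurable
  have hm3 : Measurable fun q => ‖pt (mol (φ n) F) q‖ₑ + ∑ i, ‖pd i (mol (φ n) F) q‖ₑ :=
    hm1.add (Finset.measurable_sum _ fun i _ => hm2 i)
  rw [lintegral_const_mul _ hm3,
    lintegral_add_left hm1, lintegral_finsetSum _ fun i _ => hm2 i]
  gcongr
  have b1 : ∫⁻ q in Q, ‖pt (mol (φ n) F) q‖ₑ ≤ ∫⁻ q in Q', H q := by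
    refine le_trans (le_of_eq ?_) (mol_le (φ n) hH ht hQ hQ' hs')
    refine setLIntegral_congr_fun hQ fun p hp => ?_
    rw [pt_eq_dd, mol_dd (φ n) hF wt (hs' p hp)]
  have b2 : ∀ i, ∫⁻ q in Q, ‖pd i (mol (φ n) F) q‖ₑ ≤ ∫⁻ q in Q', H q := by
    intro i
    refine le_trans (le_of_eq ?_) (mol_le (φ n) hH (hx i) hQ hQ' hs')
    refine setLIntegral_congr_fun hQ fun p hp => ?_
    rw [pd_eq_dd, mol_dd (φ n) hF (wx i) (hs' p hp)]
  calc _ ≤ (∫⁻ q in Q', H q) + ∑ i : Fin d, ∫⁻ q in Q', H q :=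
        add_le_add b1 (Finset.sum_le_sum fun i _ => b2 i)
    _ = _ := by
        simp only [Finset.sum_const, Finset.card_univ, Fintype.card_fin, nsmul_eq_mul]
        ring

end molly

/-! ### Weak derivatives of the flux -/

section flux
variable {d m : ℕ} [NeZero d] {δ : ℝ} {A : Fin d → Fin d → ℝ → CLM m}

theorem WD_line {F G : ℝ × Ed d → Em m} {e : ℝ × Ed d} (Ω : Set (ℝ × Ed d))
    (hF : Measurable F) (hG : Measurable G) {bF bG : ℝ × Ed d → ℝ}
    (cF : Continuous bF) (cG : Continuous bG) (hbF : ∀ q, ‖F q‖ ≤ bF q) (hbG : ∀ q, ‖G q‖ ≤ bG q)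
    (h : ∀ q, HasLineDerivAt ℝ F (G q) q e) : WD Ω e F G := by
  intro η hη hc hs
  have hdη := (dd_smooth e hη).continuous
  have hcη := hη.continuous
  have i1 : Integrable (fun q => dd e η q • F q) := by
    refine int_cs hc.isCompact (hdη.measurable.smul hF).aestronglyMeasurable
      (H := fun q => ‖dd e η q‖ * bF q) (by fun_prop) (fun q => ?_) (fun q hq => ?_)
    · rw [norm_smul]; gcongr; exact hbF q
    · rw [dd_off e hq, zero_smul]
  have i2 : Integrable (fun q => η q • F q) := by
    refine int_cs hc.isCompact (hcη.measurable.smul hF).aestronglyMeasurable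
      (H := fun q => ‖η q‖ * bF q) (by fun_prop) (fun q => ?_) (fun q hq => ?_)
    · rw [norm_smul]; gcongr; exact hbF q
    · rw [image_eq_zero_of_notMem_tsupport hq, zero_smul]
  have i3 : Integrable (fun q => η q • G q) := by
    refine int_cs hc.isCompact (hcη.measurable.smul hG).aestronglyMeasurable
      (H := fun q => ‖η q‖ * bG q) (by fun_prop) (fun q => ?_) (fun q hq => ?_)
    · rw [norm_smul]; gcongr; exact hbG q
    · rw [image_eq_zero_of_notMem_tsupport hq, zero_smul]
  have := integral_bilinear_hasLineDerivAt_right_eq_neg_left_of_integrable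
    (μ := (volume : Measure (ℝ × Ed d))) (f := η) (f' := dd e η) (g := F)
    (g' := G) (v := e) (B := ContinuousLinearMap.lsmul ℝ ℝ)
    (by simpa using i1) (by simpa using i3) (by simpa using i2) (fun x _ => dd_line e hη x)
    (fun x _ => h x)
  simp only [ContinuousLinearMap.lsmul_apply] at this
  rw [this, neg_neg]

/-- rows of the flux -/
def Vr (A : Fin d → Fin d → ℝ → CLM m) (γ : Fin d) (u : ℝ × Ed d → Em m) (q : ℝ × Ed d) : Em m :=
  ∑ β, A γ β (q.2 0) (pd β u q)

theorem Vr_meas (hA : CoeffsOne δ A) (γ : Fin d) {u : ℝ × Ed d → Em m}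
    (hu : ContDiff ℝ (⊤ : ℕ∞) u) : Measurable (Vr A γ u) :=
  Finset.measurable_sum _ fun β _ => A_meas hA γ β (pd_smooth β hu).continuous

theorem Vr_bound (hA : CoeffsOne δ A) (γ : Fin d) (u : ℝ × Ed d → Em m) (q : ℝ × Ed d) :
    ‖Vr A γ u q‖ ≤ δ⁻¹ * ∑ β, ‖pd β u q‖ := by
  unfold Vr
  refine (norm_sum_le _ _).trans ?_
  rw [Finset.mul_sum]
  exact Finset.sum_le_sum fun β _ => A_bound hA γ β _ _

theorem Vb_cont {u : ℝ × Ed d → Em m} (hu : ContDiff ℝ (⊤ : ℕ∞) u) :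
    Continuous (fun q => δ⁻¹ * ∑ β, ‖pd β u q‖) :=
  continuous_const.mul (continuous_finsetSum _ fun β _ => (pd_smooth β hu).continuous.norm)

theorem Vr_locInt (hA : CoeffsOne δ A) (γ : Fin d) {u : ℝ × Ed d → Em m}
    (hu : ContDiff ℝ (⊤ : ℕ∞) u) : LocallyIntegrable (Vr A γ u) :=
  (Vb_cont (δ := δ) hu).locallyIntegrable.mono (Vr_meas hA γ hu).aestronglyMeasurable
    (Filter.Eventually.of_forall fun q => (Vr_bound hA γ u q).trans (le_abs_self _))

theorem Vr_WD (hA : CoeffsOne δ A) (Ω : Set (ℝ × Ed d)) (γ α : Fin d) {u : ℝ × Ed d → Em m}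
    (hu : ContDiff ℝ (⊤ : ℕ∞) u) : WD Ω (adir α) (Vr A γ u) (Vr A γ (dd (adir α) u)) := by
  have hu' := dd_smooth (adir α) hu
  refine WD_line Ω (Vr_meas hA γ hu) (Vr_meas hA γ hu') (Vb_cont (δ := δ) hu)
    (Vb_cont (δ := δ) hu') (Vr_bound hA γ u) (Vr_bound hA γ _) fun q => ?_
  unfold HasLineDerivAt Vr
  refine HasDerivAt.fun_sum fun β _ => ?_
  have := A_line (A := A) γ β (pd_smooth β hu) (adir α) q (adir_adm α)
  rw [pd_eq_dd, dd_comm _ _ hu, ← pd_eq_dd] at this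
  rw [pd_eq_dd]
  exact this

theorem smul_int {F : ℝ × Ed d → Em m} (hF : Measurable F) {bF : ℝ × Ed d → ℝ}
    (cF : Continuous bF) (hbF : ∀ q, ‖F q‖ ≤ bF q) {η : ℝ × Ed d → ℝ} (hη : Continuous η)
    (hc : HasCompactSupport η) : Integrable (fun q => η q • F q) := by
  refine int_cs hc.isCompact (hη.measurable.smul hF).aestronglyMeasurable
    (H := fun q => ‖η q‖ * bF q) (by fun_prop) (fun q => ?_) (fun q hq => ?_)
  · rw [norm_smul]; gcongr; exact hbF q
  · rw [image_eq_zero_of_notMem_tsupport hq, zero_smul]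

/-- the weak `x_0` derivative of the flux -/
def G0 (A : Fin d → Fin d → ℝ → CLM m) (u : ℝ × Ed d → Em m) (q : ℝ × Ed d) : Em m :=
  pt u q - ∑ α ∈ Finset.univ.erase 0, Vr A α (dd (adir α) u) q

theorem U_WD0 (hδ : 0 < δ) (hA : CoeffsOne δ A) {Ω : Set (ℝ × Ed d)} {u : ℝ × Ed d → Em m}
    (hu : ContDiff ℝ (⊤ : ℕ∞) u) (hw : WS A Ω u) :
    WD Ω (0, EuclideanSpace.single 0 1) (Vr A 0 u) (G0 A u) := by
  intro η hη hc hs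
  have cpt : Continuous (pt u) := (dd_smooth (1,0) hu).continuous
  have ipt : Integrable (fun q => η q • pt u q) :=
    smul_int cpt.measurable cpt.norm (fun _ => le_rfl) hη.continuous hc
  have iV : ∀ α, Integrable (fun q => pd α η q • Vr A α u q) := fun α =>
    smul_int (Vr_meas hA α hu) (Vb_cont (δ := δ) hu) (Vr_bound hA α u) (pd_smooth α hη).continuous
      (dd_compact _ hc)
  have iW : ∀ α, Integrable (fun q => η q • Vr A α (dd (adir α) u) q) := fun α =>
    smul_int (Vr_meas hA α (dd_smooth _ hu)) (Vb_cont (δ := δ) (dd_smooth _ hu))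
      (Vr_bound hA α _) hη.continuous hc
  have key : (∫ q, η q • pt u q) + ∑ α, ∫ q, pd α η q • Vr A α u q = 0 := by
    rw [← integral_finsetSum _ fun α _ => iV α, ← integral_add ipt
      (integrable_finsetSum _ fun α _ => iV α)]
    have itot : Integrable (fun q => η q • pt u q + ∑ α, pd α η q • Vr A α u q) :=
      ipt.add (integrable_finsetSum Finset.univ fun α _ => iV α)
    refine ext_inner_left ℝ fun w => ?_
    rw [inner_zero_right, ← integral_inner itot w]
    have h1 := hw (fun q => η q • w) (hη.smul contDiff_const) hc.smul_right
      ((closure_mono (support_smul_subset_left _ _)).trans hs)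
    rw [← h1]
    congr 1
    funext q
    have hpd : ∀ α, pd α (fun q => η q • w) q = pd α η q • w := by
      intro α
      rw [pd_eq_dd, dd_mul _ hη contDiff_const]
      simp [dd, pd]
    simp only [Bf, hpd, inner_add_right, inner_smul_right, inner_sum, Vr]
    congr 1
    · rw [real_inner_comm]
    · refine Finset.sum_congr rfl fun α _ => ?_
      rw [Finset.mul_sum]
      refine Finset.sum_congr rfl fun β _ => ?_
      rw [real_inner_comm]
  rw [← Finset.add_sum_erase Finset.univ _ (Finset.mem_univ (0 : Fin d))] at key
  have h2 : ∀ α ∈ Finset.univ.erase (0 : Fin d), ∫ q, pd α η q • Vr A α u q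
      = -∫ q, η q • Vr A α (dd (adir α) u) q := by
    intro α hα
    have hα0 := (Finset.mem_erase.1 hα).1
    have := Vr_WD hA Ω α α hu η hη hc hs
    simpa [adir, hα0, pd_eq_dd] using this
  rw [Finset.sum_congr rfl h2, Finset.sum_neg_distrib] at key
  rw [← pd_eq_dd]
  have e : ∫ q, η q • G0 A u q = (∫ q, η q • pt u q) -
      ∑ α ∈ Finset.univ.erase 0, ∫ q, η q • Vr A α (dd (adir α) u) q := by
    rw [← integral_finsetSum _ fun α _ => iW α, ← integral_sub ipt
      (integrable_finsetSum _ fun α _ => iW α)]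
    congr 1
    funext q
    rw [G0, smul_sub, Finset.smul_sum]
  rw [e]
  rw [← sub_eq_zero, ← key]
  abel

/-- pointwise majorant of all the derivatives -/
def Hb (δ : ℝ) (u : ℝ × Ed d → Em m) (q : ℝ × Ed d) : ℝ :=
  ‖pt u q‖ + δ⁻¹ * ∑ α, ∑ β, ‖pd β (dd (adir α) u) q‖

theorem Hb_cont (δ : ℝ) {u : ℝ × Ed d → Em m} (hu : ContDiff ℝ (⊤ : ℕ∞) u) :
    Continuous (Hb δ u) := by
  have cpt : Continuous (pt u) := (dd_smooth (1,0) hu).continuous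
  exact cpt.norm.add (continuous_const.mul (continuous_finsetSum _ fun α _ =>
    continuous_finsetSum _ fun β _ => (pd_smooth β (dd_smooth _ hu)).continuous.norm))

theorem Hb_Vr (hδ : 0 < δ) (hA : CoeffsOne δ A) (γ α : Fin d) (u : ℝ × Ed d → Em m)
    (q : ℝ × Ed d) : ‖Vr A γ (dd (adir α) u) q‖ ≤ Hb δ u q := by
  refine (Vr_bound hA γ _ q).trans ?_
  have h1 : ∑ β, ‖pd β (dd (adir α) u) q‖ ≤ ∑ α, ∑ β, ‖pd β (dd (adir α) u) q‖ :=
    Finset.single_le_sum (f := fun α => ∑ β, ‖pd β (dd (adir α) u) q‖)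
      (fun _ _ => by positivity) (Finset.mem_univ α)
  have h2 : δ⁻¹ * ∑ β, ‖pd β (dd (adir α) u) q‖ ≤
    δ⁻¹ * ∑ α, ∑ β, ‖pd β (dd (adir α) u) q‖ := by gcongr
  unfold Hb
  linarith [norm_nonneg (pt u q)]

theorem Hb_G0 (hδ : 0 < δ) (hA : CoeffsOne δ A) (u : ℝ × Ed d → Em m)
    (q : ℝ × Ed d) : ‖G0 A u q‖ ≤ Hb δ u q := by
  unfold G0 Hb
  refine (norm_sub_le _ _).trans ?_
  gcongr
  refine (norm_sum_le _ _).trans ?_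
  rw [Finset.mul_sum]
  refine (Finset.sum_le_sum fun α _ => Vr_bound hA α _ q).trans ?_
  exact Finset.sum_le_sum_of_subset_of_nonneg (Finset.erase_subset _ _)
    (fun _ _ _ => by positivity)

theorem Hb_pd (hδ : 0 < δ) (hδ1 : δ ≤ 1) (α β : Fin d) (u : ℝ × Ed d → Em m)
    (q : ℝ × Ed d) : ‖pd β (dd (adir α) u) q‖ ≤ Hb δ u q := by
  have h0 : ‖pd β (dd (adir α) u) q‖ ≤ ∑ γ, ‖pd γ (dd (adir α) u) q‖ :=
    Finset.single_le_sum (f := fun γ => ‖pd γ (dd (adir α) u) q‖)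
      (fun _ _ => norm_nonneg _) (Finset.mem_univ β)
  have h1 : ∑ γ, ‖pd γ (dd (adir α) u) q‖ ≤ ∑ α', ∑ γ, ‖pd γ (dd (adir α') u) q‖ :=
    Finset.single_le_sum (f := fun α' => ∑ γ, ‖pd γ (dd (adir α') u) q‖)
      (fun _ _ => Finset.sum_nonneg fun _ _ => norm_nonneg _) (Finset.mem_univ α)
  have h2 : (1:ℝ) ≤ δ⁻¹ := (one_le_inv₀ hδ).2 hδ1
  have h3 : 0 ≤ ∑ α', ∑ γ, ‖pd γ (dd (adir α') u) q‖ :=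
    Finset.sum_nonneg fun _ _ => Finset.sum_nonneg fun _ _ => norm_nonneg _
  have h4 := le_mul_of_one_le_left h3 h2
  have h5 := norm_nonneg (pt u q)
  show _ ≤ ‖pt u q‖ + δ⁻¹ * ∑ α', ∑ γ, ‖pd γ (dd (adir α') u) q‖
  exact (h0.trans h1).trans (h4.trans (le_add_of_nonneg_left h5))

theorem Qm_convex (a b s : ℝ) : Convex ℝ (Qm a b s : Set (ℝ × Ed d)) :=
  (convex_Ioo _ _).prod (convex_ball _ _)

theorem Qm_nhd {ρ τ : ℝ} (hρ : 0 < ρ) (hτ : 0 < τ) : ∃ ε : ℝ, 0 < ε ∧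
    ∀ p ∈ (Qm (ρ ^ 2) τ ρ : Set (ℝ × Ed d)), closedBall p ε ⊆ Qm (4 * ρ ^ 2) (τ / 2) (2 * ρ) := by
  have h2 : 0 < ρ ^ 2 := by positivity
  refine ⟨min (τ / 2) (min ρ (ρ ^ 2)), by positivity, ?_⟩
  rintro ⟨t, x⟩ ⟨⟨h3, h4⟩, h5⟩ ⟨s, y⟩ hq
  rw [mem_closedBall, Prod.dist_eq, max_le_iff] at hq
  obtain ⟨hq1, hq2⟩ := hq
  simp only [le_min_iff] at hq1 hq2
  simp only [Real.dist_eq, abs_le] at hq1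
  simp only [mem_ball] at h5
  simp only at h3 h4
  refine ⟨⟨?_, ?_⟩, ?_⟩
  · simp only; linarith [hq1.2.2.1]
  · simp only; linarith [hq1.1.2]
  · simp only [mem_ball]
    have := dist_triangle y x 0
    linarith [hq2.2.1]

theorem osc_gen {ρ τ : ℝ} (hρ : 0 < ρ) (hρ1 : ρ ≤ 1) (hτ : 0 < τ)
    {F Gt : ℝ × Ed d → Em m} {Gx : Fin d → ℝ × Ed d → Em m}
    (hF : LocallyIntegrable F) {H : ℝ × Ed d → ℝ} (hH : Continuous H)
    (ht : ∀ q, ‖Gt q‖ ≤ H q) (hx : ∀ i q, ‖Gx i q‖ ≤ H q)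
    (wt : WD (Qm (4 * ρ ^ 2) (τ / 2) (2 * ρ)) (1, 0) F Gt)
    (wx : ∀ i, WD (Qm (4 * ρ ^ 2) (τ / 2) (2 * ρ)) (0, EuclideanSpace.single i 1) F (Gx i)) :
    ∫⁻ p in Qm (ρ ^ 2) τ ρ, ∫⁻ q in Qm (ρ ^ 2) τ ρ, ‖F p - F q‖ₑ ≤
      2 ^ (d + 1) * (ENNReal.ofReal (2 * ρ) * ((d + 1) *
        ENNReal.ofReal (∫ q in Qm (4 * ρ ^ 2) (τ / 2) (2 * ρ), H q))) *
        volume (Qm (ρ ^ 2) τ ρ : Set (ℝ × Ed d)) := by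
  obtain ⟨ε, hε, hs⟩ := Qm_nhd (d := d) hρ hτ
  have hH0 : ∀ q, 0 ≤ H q := fun q => (norm_nonneg _).trans (ht q)
  have conv : ∀ (x : Em m) (y : ℝ), ‖x‖ ≤ y → ‖x‖ₑ ≤ ENNReal.ofReal y := fun x y h => by
    rw [← ofReal_norm]; exact ENNReal.ofReal_le_ofReal h
  have := poin_weak hF (H := fun q => ENNReal.ofReal (H q)) (by fun_prop)
    (fun q => conv _ _ (ht q)) (fun i q => conv _ _ (hx i q)) (Qm_meas _ _ _) (Qm_meas _ _ _)
    (Qm_convex _ _ _) hε hs wt wx (c := 2 * ρ)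
    (by
      rintro p ⟨⟨h1, h2⟩, -⟩ q ⟨⟨h3, h4⟩, -⟩
      rw [abs_le]; constructor <;> nlinarith)
    (by
      rintro p ⟨-, h1⟩ q ⟨-, h2⟩ i
      rw [mem_ball_zero_iff] at h1 h2
      have h3 := (PiLp.norm_apply_le p.2 i).trans h1.le
      have h4 := (PiLp.norm_apply_le q.2 i).trans h2.le
      rw [Real.norm_eq_abs, abs_le] at h3 h4
      rw [abs_le]; constructor <;> linarith)
  rwa [← ofReal_integral_eq_lintegral_ofReal (Qm_int hH _ _ _)
    (Filter.Eventually.of_forall hH0)] at this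

theorem osc_U (hδ : 0 < δ) {ρ τ : ℝ} (hρ : 0 < ρ) (hρ1 : ρ ≤ 1/4) (hτ : 0 < τ)
    (hA : CoeffsOne δ A) {u : ℝ × Ed d → Em m}
    (hu : ContDiff ℝ (⊤ : ℕ∞) u) (hw : WS A (Qc0 1) u) :
    ∫⁻ p in Qm (ρ ^ 2) τ ρ, ∫⁻ q in Qm (ρ ^ 2) τ ρ, ‖Vr A 0 u p - Vr A 0 u q‖ₑ ≤
      2 ^ (d + 1) * (ENNReal.ofReal (2 * ρ) * ((d + 1) *
        ENNReal.ofReal (∫ q in Qm (4 * ρ ^ 2) (τ / 2) (2 * ρ), Hb δ u q))) *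
        volume (Qm (ρ ^ 2) τ ρ : Set (ℝ × Ed d)) := by
  have hsub : (Qm (4 * ρ ^ 2) (τ / 2) (2 * ρ) : Set (ℝ × Ed d)) ⊆ Qc0 1 := by
    rw [Qc0_eq]
    rintro q ⟨⟨h1, h2⟩, h3⟩
    rw [mem_ball_zero_iff] at h3
    refine ⟨⟨by nlinarith, by linarith⟩, ?_⟩
    rw [mem_ball_zero_iff]
    linarith
  refine osc_gen hρ (by linarith) hτ (Vr_locInt hA 0 hu) (Hb_cont δ hu)
    (Gt := Vr A 0 (dd (adir 0) u))
    (Gx := fun i => if i = 0 then G0 A u else Vr A 0 (dd (adir i) u))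
    (Hb_Vr hδ hA 0 0 u) ?_ ?_ ?_
  · intro i q
    by_cases hi : i = 0
    · simp only [hi, if_true]; exact Hb_G0 hδ hA u q
    · simp only [hi, if_false]; exact Hb_Vr hδ hA 0 i u q
  · have := Vr_WD hA (Qm (4 * ρ ^ 2) (τ / 2) (2 * ρ)) 0 0 hu
    simpa [adir] using this
  · intro i
    by_cases hi : i = 0
    · subst hi
      simp only [if_true]
      exact fun η h1 h2 h3 => U_WD0 hδ hA hu hw η h1 h2 (h3.trans hsub)
    · have := Vr_WD hA (Qm (4 * ρ ^ 2) (τ / 2) (2 * ρ)) 0 i hu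
      simp only [hi, if_false]
      simpa [adir, hi] using this

theorem osc_D (hδ : 0 < δ) (hδ1 : δ ≤ 1) {ρ τ : ℝ} (hρ : 0 < ρ) (hρ1 : ρ ≤ 1/4) (hτ : 0 < τ)
    {u : ℝ × Ed d → Em m} (hu : ContDiff ℝ (⊤ : ℕ∞) u) {α : Fin d} (hα : α ≠ 0) :
    ∫⁻ p in Qm (ρ ^ 2) τ ρ, ∫⁻ q in Qm (ρ ^ 2) τ ρ, ‖pd α u p - pd α u q‖ₑ ≤
      2 ^ (d + 1) * (ENNReal.ofReal (2 * ρ) * ((d + 1) *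
        ENNReal.ofReal (∫ q in Qm (4 * ρ ^ 2) (τ / 2) (2 * ρ), Hb δ u q))) *
        volume (Qm (ρ ^ 2) τ ρ : Set (ℝ × Ed d)) := by
  have hs := pd_smooth α hu
  have hW : ∀ (Ω : Set (ℝ × Ed d)) (e : ℝ × Ed d), WD Ω e (pd α u) (dd e (pd α u)) := by
    intro Ω e
    have h1 := hs.continuous
    have h2 := (dd_smooth e hs).continuous
    exact WD_line Ω h1.measurable h2.measurable h1.norm h2.norm (fun _ => le_rfl)
      (fun _ => le_rfl) (dd_line e hs)
  refine osc_gen hρ (by linarith) hτ hs.continuous.locallyIntegrable (Hb_cont δ hu)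
    (fun q => ?_) (fun i q => ?_) (hW _ _) (fun i => hW _ _)
  · have := Hb_pd hδ hδ1 0 α u q
    rw [pd_eq_dd, dd_comm _ _ hu, ← pd_eq_dd]
    simpa [adir] using this
  · have := Hb_pd hδ hδ1 α i u q
    rw [dd_adir_ne hα] at this
    exact this

end flux

/-! ### Oscillation estimate at unit scale -/

section unitscale
variable {d m : ℕ} [NeZero d] {δ : ℝ} {A : Fin d → Fin d → ℝ → CLM m}

/-- volume of the unit ball -/
def om (d : ℕ) : ℝ := (volume : Measure (Ed d)).real (ball 0 1)

theorem om_pos : 0 < om d := by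
  unfold om
  exact ENNReal.toReal_pos (measure_ball_pos _ _ one_pos).ne' measure_ball_lt_top.ne

theorem Qm_vol {a b s : ℝ} (hab : b ≤ a) (hs : 0 ≤ s) :
    (volume : Measure (ℝ × Ed d)).real (Qm a b s) = (a - b) * (s ^ d * om d) := by
  unfold Qm Measure.real
  rw [Measure.volume_eq_prod, Measure.prod_prod, ENNReal.toReal_mul, Real.volume_Ioo,
    ENNReal.toReal_ofReal (by linarith)]
  congr 1
  · ring
  · have := Measure.addHaar_ball (volume : Measure (Ed d)) 0 hs
    rw [this, ENNReal.toReal_mul, ENNReal.toReal_ofReal (by positivity)]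
    simp [Measure.real, om]

theorem Qm_fin (a b s : ℝ) : (volume : Measure (ℝ × Ed d)) (Qm a b s) < ⊤ :=
  (measure_mono (Qm_sub_cpt a b s)).trans_lt
    (isCompact_Icc.prod (isCompact_closedBall _ _)).measure_lt_top

theorem cs_sq {S : Set (ℝ × Ed d)} (hS : volume S < ⊤) {f : ℝ × Ed d → ℝ}
    (hf : IntegrableOn f S) (hf2 : IntegrableOn (fun q => f q ^ 2) S) (h0 : ∀ q, 0 ≤ f q) :
    ∫ q in S, f q ≤ √((volume : Measure (ℝ × Ed d)).real S * ∫ q in S, f q ^ 2) := by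
  apply Real.le_sqrt_of_sq_le
  set V := (volume : Measure (ℝ × Ed d)).real S with hV
  set I := ∫ q in S, f q with hI
  have hfin : IsFiniteMeasure (volume.restrict S : Measure (ℝ × Ed d)) :=
    ⟨by simpa using hS⟩
  have hV0 : 0 ≤ V := measureReal_nonneg
  have e : ∫ q in S, (V * f q - I) ^ 2 = V * (V * (∫ q in S, f q ^ 2) - I ^ 2) := by
    have : ∀ q, (V * f q - I) ^ 2 = V ^ 2 * f q ^ 2 - (2 * V * I) * f q + I ^ 2 := fun q => by ring
    simp_rw [this]
    have i1 : IntegrableOn (fun q => V ^ 2 * f q ^ 2 - (2 * V * I) * f q) S :=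
      (hf2.const_mul _).sub (hf.const_mul _)
    rw [integral_add i1 (integrable_const _), integral_sub (hf2.const_mul _) (hf.const_mul _), integral_const_mul, integral_const_mul,
      setIntegral_const, ← hI, ← hV, smul_eq_mul]
    ring
  have h1 : 0 ≤ V * (V * (∫ q in S, f q ^ 2) - I ^ 2) := by
    rw [← e]; exact integral_nonneg fun q => sq_nonneg _
  rcases hV0.eq_or_lt with h | h
  · have : volume S = 0 := by
      exact (measureReal_eq_zero_iff hS.ne).1 h.symm
    rw [hI, setIntegral_measure_zero _ this, ← h]; simp
  · nlinarith [(mul_nonneg_iff_of_pos_left h).1 h1]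

theorem Hb_bd (hδ : 0 < δ) : ∃ N : ℝ, 0 ≤ N ∧ ∀ ρ τ : ℝ, 0 < ρ → ρ ≤ 1/4 → 0 < τ → τ < ρ ^ 2 →
    ∀ (A : Fin d → Fin d → ℝ → CLM m) (u : ℝ × Ed d → Em m), CoeffsOne δ A →
    ContDiff ℝ (⊤ : ℕ∞) u → WS A (Qc0 1) u →
    ∫ q in Qm (4 * ρ ^ 2) (τ / 2) (2 * ρ), Hb δ u q ≤
      N * √(ρ ^ (2 * d + 3) * ∫ q in Qc0 1, gradSq u q) := by
  obtain ⟨N, hN, h⟩ := L2bd (d := d) (m := m) hδ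
  refine ⟨(1 + δ⁻¹ * ∑ α : Fin d, ∑ β : Fin d, 1) * √(4 * 2 ^ d * om d * N), by positivity, ?_⟩
  intro ρ τ hρ hρ1 hτ hτ1 A u hA hu hw
  obtain ⟨h1, h2⟩ := h ρ τ hρ hρ1 hτ (by nlinarith) A u hA hu hw
  set M := ∫ q in Qc0 1, gradSq u q
  have hom := om_pos (d := d)
  have gen : ∀ g : ℝ × Ed d → Em m, Continuous g →
      ∫ q in Qm (4 * ρ ^ 2) (τ / 2) (2 * ρ), ‖g q‖ ^ 2 ≤ N * ρ ^ (d + 1) * M →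
      ∫ q in Qm (4 * ρ ^ 2) (τ / 2) (2 * ρ), ‖g q‖ ≤
        √(4 * 2 ^ d * om d * N) * √(ρ ^ (2 * d + 3) * M) := by
    intro g hg hb
    refine (cs_sq (Qm_fin _ _ _) (Qm_int hg.norm _ _ _) (Qm_int (hg.norm.pow 2) _ _ _)
      (fun q => norm_nonneg _)).trans ?_
    rw [← Real.sqrt_mul (by positivity)]
    apply Real.sqrt_le_sqrt
    rw [Qm_vol (by nlinarith) (by positivity)]
    have hI : 0 ≤ ∫ q in Qm (4 * ρ ^ 2) (τ / 2) (2 * ρ), ‖g q‖ ^ 2 :=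
      integral_nonneg fun q => sq_nonneg _
    calc _ ≤ (4 * ρ ^ 2) * ((2 * ρ) ^ d * om d) * (N * ρ ^ (d + 1) * M) := by
          gcongr; linarith
      _ = _ := by rw [mul_pow]; ring
  have hpt := gen (pt u) (dd_smooth (1,0) hu).continuous h2
  have cpt : Continuous (pt u) := (dd_smooth (1,0) hu).continuous
  have cc : ∀ α β, Continuous (pd β (dd (adir α) u)) := fun α β =>
    (pd_smooth β (dd_smooth _ hu)).continuous
  unfold Hb
  rw [integral_add (Qm_int cpt.norm _ _ _) ((integrable_finsetSum _ fun α _ =>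
    integrable_finsetSum _ fun β _ => Qm_int (cc α β).norm _ _ _).const_mul _),
    integral_const_mul, integral_finsetSum _ fun α _ =>
    integrable_finsetSum _ fun β _ => Qm_int (cc α β).norm _ _ _]
  rw [add_mul, add_mul, one_mul, mul_assoc δ⁻¹, mul_assoc δ⁻¹, Finset.sum_mul, Finset.sum_mul]
  refine add_le_add hpt (mul_le_mul_of_nonneg_left (Finset.sum_le_sum fun α _ => ?_)
    (by positivity))
  rw [integral_finsetSum _ fun β _ => Qm_int (cc α β).norm _ _ _, Finset.sum_mul, Finset.sum_mul]
  refine Finset.sum_le_sum fun β _ => ?_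
  rw [one_mul]
  exact gen _ (cc α β) (h1 α β)

theorem osc_lim {F : ℝ × Ed d → Em m} (hF : Measurable F) {ρ : ℝ} (hρ : 0 < ρ) {C : ℝ≥0∞}
    (h : ∀ τ, 0 < τ → τ < ρ ^ 2 →
      ∫⁻ p in Qm (ρ ^ 2) τ ρ, ∫⁻ q in Qm (ρ ^ 2) τ ρ, ‖F p - F q‖ₑ ≤ C) :
    ∫⁻ p in Qc0 ρ, ∫⁻ q in Qc0 ρ, ‖F p - F q‖ₑ ≤ C := by
  have mf : Measurable (fun z : (ℝ × Ed d) × (ℝ × Ed d) => ‖F z.1 - F z.2‖ₑ) := by fun_prop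
  have conv : ∀ S : Set (ℝ × Ed d), ∫⁻ p in S, ∫⁻ q in S, ‖F p - F q‖ₑ =
      ∫⁻ z in S ×ˢ S, ‖F z.1 - F z.2‖ₑ := by
    intro S
    rw [Measure.volume_eq_prod (ℝ × Ed d) (ℝ × Ed d), ← Measure.prod_restrict,
      lintegral_prod _ mf.aemeasurable]
  let τ : ℕ → ℝ := fun n => ρ ^ 2 / (n + 2)
  have hτ0 : ∀ n, 0 < τ n := fun n => by positivity
  have hτ1 : ∀ n, τ n < ρ ^ 2 := fun n => by
    have : (0:ℝ) ≤ n := Nat.cast_nonneg n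
    exact div_lt_self (by positivity) (by linarith)
  have hanti : Antitone τ := fun a b hab => by
    have : (a:ℝ) ≤ b := by exact_mod_cast hab
    show ρ ^ 2 / (b + 2) ≤ ρ ^ 2 / (a + 2)
    gcongr
  have hmono : Monotone (fun n => (Qm (ρ ^ 2) (τ n) ρ : Set (ℝ × Ed d))) := by
    intro a b hab
    exact prod_mono (Ioo_subset_Ioo le_rfl (neg_le_neg (hanti hab))) subset_rfl
  have hU : (Qc0 ρ : Set (ℝ × Ed d)) = ⋃ n, Qm (ρ ^ 2) (τ n) ρ := by
    rw [Qc0_eq]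
    ext ⟨t, x⟩
    simp only [mem_iUnion]
    constructor
    · rintro ⟨⟨h1, h2⟩, h3⟩
      simp only [neg_zero] at h1 h2
      obtain ⟨n, hn⟩ := exists_nat_gt (ρ ^ 2 / (-t))
      refine ⟨n, ⟨h1, ?_⟩, h3⟩
      have ht : 0 < -t := by linarith
      rw [div_lt_iff₀ ht] at hn
      show t < - (ρ ^ 2 / (n + 2))
      rw [lt_neg, div_lt_iff₀ (by positivity)]
      nlinarith
    · rintro ⟨n, ⟨h1, h2⟩, h3⟩
      exact ⟨⟨h1, by simp only at h2 ⊢; linarith [hτ0 n]⟩, h3⟩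
  have hU2 : (Qc0 ρ ×ˢ Qc0 ρ : Set ((ℝ × Ed d) × (ℝ × Ed d))) =
      ⋃ n, Qm (ρ ^ 2) (τ n) ρ ×ˢ Qm (ρ ^ 2) (τ n) ρ := by
    rw [hU, iUnion_prod_of_monotone hmono hmono]
  rw [conv, hU2, setLIntegral_iUnion_of_directed]
  · refine iSup_le fun n => ?_
    rw [← conv]
    exact h _ (hτ0 n) (hτ1 n)
  · exact (hmono.set_prod hmono).directed_le

theorem osc_avg {F : ℝ × Ed d → Em m} (hF : Measurable F) {S : Set (ℝ × Ed d)}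
    (h0 : volume S ≠ 0) (h1 : volume S ≠ ⊤) (hi : IntegrableOn F S) {C : ℝ} (hC : 0 ≤ C)
    (h : ∫⁻ p in S, ∫⁻ q in S, ‖F p - F q‖ₑ ≤ ENNReal.ofReal C * volume S) :
    ⨍ p in S, ‖F p - ⨍ q in S, F q‖ ≤ ((volume : Measure (ℝ × Ed d)).real S)⁻¹ * C := by
  have hfin : IsFiniteMeasure (volume.restrict S : Measure (ℝ × Ed d)) :=
    ⟨by simpa using h1.lt_top⟩
  have hV : (volume : Measure (ℝ × Ed d)).real S ≠ 0 := by
    rw [Ne, measureReal_eq_zero_iff h1]; exact h0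
  rw [setAverage_eq, smul_eq_mul]
  refine mul_le_mul_of_nonneg_left ?_ (by positivity)
  have mF : Measurable (fun p => F p - ⨍ q in S, F q) := hF.sub_const _
  rw [integral_norm_eq_lintegral_enorm mF.aestronglyMeasurable]
  refine ENNReal.toReal_le_of_le_ofReal hC ?_
  have key : ∀ p, ‖F p - ⨍ q in S, F q‖ₑ ≤ (volume S)⁻¹ * ∫⁻ q in S, ‖F p - F q‖ₑ := by
    intro p
    have e : F p - ⨍ q in S, F q =
        ((volume : Measure (ℝ × Ed d)).real S)⁻¹ • ∫ q in S, (F p - F q) := by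
      rw [integral_sub (integrable_const _) hi, setIntegral_const, smul_sub, smul_smul,
        inv_mul_cancel₀ hV, one_smul, setAverage_eq]
    rw [e, enorm_smul]
    gcongr
    · rw [Measure.real, ← ENNReal.toReal_inv, Real.enorm_of_nonneg ENNReal.toReal_nonneg,
        ENNReal.ofReal_toReal (by simpa using h0)]
    · exact enorm_integral_le_lintegral_enorm _
  calc ∫⁻ p in S, ‖F p - ⨍ q in S, F q‖ₑ
      ≤ ∫⁻ p in S, (volume S)⁻¹ * ∫⁻ q in S, ‖F p - F q‖ₑ := lintegral_mono key
    _ = (volume S)⁻¹ * ∫⁻ p in S, ∫⁻ q in S, ‖F p - F q‖ₑ :=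
        lintegral_const_mul' _ _ (by simpa using h0)
    _ ≤ (volume S)⁻¹ * (ENNReal.ofReal C * volume S) := by gcongr
    _ = ENNReal.ofReal C := by
        rw [mul_comm, mul_assoc, ENNReal.mul_inv_cancel h0 h1, mul_one]

theorem unit_osc (hδ : 0 < δ) (hδ1 : δ ≤ 1) : ∃ N : ℝ, 0 ≤ N ∧ ∀ ρ : ℝ, 0 < ρ → ρ ≤ 1/4 →
    ∀ (A : Fin d → Fin d → ℝ → CLM m) (u : ℝ × Ed d → Em m), CoeffsOne δ A →
    ContDiff ℝ (⊤ : ℕ∞) u → WS A (Qc0 1) u →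
    (⨍ q in Qc0 (d := d) ρ, ‖Ubar A u q - (⨍ q' in Qc0 (d := d) ρ, Ubar A u q')‖)
        ≤ N * √ρ * √(⨍ q in Qc0 (d := d) 1, gradSq u q) ∧
    ∀ α : Fin d, α ≠ 0 →
      (⨍ q in Qc0 (d := d) ρ, ‖pd α u q - (⨍ q' in Qc0 (d := d) ρ, pd α u q')‖)
        ≤ N * √ρ * √(⨍ q in Qc0 (d := d) 1, gradSq u q) := by
  obtain ⟨N, hN, h⟩ := Hb_bd (d := d) (m := m) hδ
  have hom := om_pos (d := d)
  refine ⟨2 ^ (d + 1) * 2 * (d + 1) * N * (om d)⁻¹ * √(om d), by positivity, ?_⟩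
  intro ρ hρ hρ1 A u hA hu hw
  set M := ∫ q in Qc0 1, gradSq u q with hM
  have hM0 : 0 ≤ M := integral_nonneg fun q => gradSq_nonneg _ _
  have vol1 : (volume : Measure (ℝ × Ed d)).real (Qc0 1) = om d := by
    rw [Qc0_eq, Qm_vol (by norm_num) (by norm_num)]; simp
  have volρ : (volume : Measure (ℝ × Ed d)).real (Qc0 ρ) = ρ ^ (d + 2) * om d := by
    rw [Qc0_eq, Qm_vol (by positivity) hρ.le]; ring
  have hfin : volume (Qc0 ρ : Set (ℝ × Ed d)) ≠ ⊤ := by rw [Qc0_eq]; exact (Qm_fin _ _ _).ne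
  have hne : volume (Qc0 ρ : Set (ℝ × Ed d)) ≠ 0 := by
    intro h0
    have : (volume : Measure (ℝ × Ed d)).real (Qc0 ρ) = 0 := by simp [Measure.real, h0]
    rw [volρ] at this
    have : 0 < ρ ^ (d + 2) * om d := by positivity
    linarith
  have main : ∀ F : ℝ × Ed d → Em m, Measurable F → LocallyIntegrable F →
      (∀ τ, 0 < τ → τ < ρ ^ 2 →
        ∫⁻ p in Qm (ρ ^ 2) τ ρ, ∫⁻ q in Qm (ρ ^ 2) τ ρ, ‖F p - F q‖ₑ ≤
        2 ^ (d + 1) * (ENNReal.ofReal (2 * ρ) * ((d + 1) *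
        ENNReal.ofReal (∫ q in Qm (4 * ρ ^ 2) (τ / 2) (2 * ρ), Hb δ u q))) *
        volume (Qm (ρ ^ 2) τ ρ : Set (ℝ × Ed d))) →
      (⨍ q in Qc0 (d := d) ρ, ‖F q - (⨍ q' in Qc0 (d := d) ρ, F q')‖)
        ≤ 2 ^ (d + 1) * 2 * (d + 1) * N * (om d)⁻¹ * √(om d) * √ρ *
          √(⨍ q in Qc0 (d := d) 1, gradSq u q) := by
    intro F mF iF hF
    have hlim := osc_lim (C := ENNReal.ofReal (2 ^ (d + 1) * (2 * ρ * ((d + 1) *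
      (N * √(ρ ^ (2 * d + 3) * M))))) * volume (Qc0 ρ : Set (ℝ × Ed d))) mF hρ ?_
    · have iF' : IntegrableOn F (Qc0 ρ) := by
        rw [Qc0_eq]
        exact (iF.integrableOn_isCompact
          (isCompact_Icc.prod (isCompact_closedBall _ _))).mono_set (Qm_sub_cpt _ _ _)
      refine (osc_avg mF hne hfin iF' (by positivity) hlim).trans (le_of_eq ?_)
      rw [setAverage_eq, vol1, volρ, smul_eq_mul, ← hM]
      have e1 : √(ρ ^ (2 * d + 3) * M) = ρ ^ (d + 1) * √ρ * √M := by
        rw [show ρ ^ (2 * d + 3) * M = (ρ ^ (d + 1)) ^ 2 * (ρ * M) by ring,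
          Real.sqrt_mul (by positivity), Real.sqrt_sq (by positivity), Real.sqrt_mul hρ.le]
        ring
      have e2 : √(om d) * √((om d)⁻¹ * M) = √M := by
        rw [← Real.sqrt_mul hom.le, mul_inv_cancel_left₀ hom.ne']
      rw [e1, ← e2]
      have hρ0 := hρ.ne'
      have hom0 := hom.ne'
      generalize √((om d)⁻¹ * M) = X
      generalize √(om d) = Y
      generalize √ρ = Z
      field_simp
      ring
    · intro τ hτ hτ1
      refine (hF τ hτ hτ1).trans ?_
      have hb := h ρ τ hρ hρ1 hτ hτ1 A u hA hu hw
      rw [ENNReal.ofReal_mul (p := 2 ^ (d + 1)) (by positivity),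
        ENNReal.ofReal_mul (p := 2 * ρ) (by positivity), ENNReal.ofReal_mul (p := (d:ℝ) + 1) (by positivity)]
      have e3 : ENNReal.ofReal (2 ^ (d + 1)) = 2 ^ (d + 1) := by
        rw [ENNReal.ofReal_pow (by norm_num)]; simp
      have e4 : ENNReal.ofReal ((d:ℝ) + 1) = d + 1 := by
        rw [ENNReal.ofReal_add (by positivity) (by norm_num)]; simp
      rw [e3, e4]
      have hsub : (Qm (ρ ^ 2) τ ρ : Set (ℝ × Ed d)) ⊆ Qc0 ρ := by
        rw [Qc0_eq]
        exact prod_mono (Ioo_subset_Ioo le_rfl (by linarith)) subset_rfl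
      gcongr
  refine ⟨main (Ubar A u) (Vr_meas hA 0 hu) (Vr_locInt hA 0 hu)
    (fun τ hτ _ => osc_U hδ hρ hρ1 hτ hA hu hw), fun α hα => ?_⟩
  exact main (pd α u) (pd_smooth α hu).continuous.measurable
    (pd_smooth α hu).continuous.locallyIntegrable
    (fun τ hτ _ => osc_D hδ hδ1 hρ (by linarith) hτ hu hα)

end unitscale

/-! ### Parabolic scaling -/

section scaling
variable {d m : ℕ} [NeZero d] {δ : ℝ} {A : Fin d → Fin d → ℝ → CLM m}

/-- parabolic dilation -/
def TL (d : ℕ) {R : ℝ} (hR : 0 < R) : (ℝ × Ed d) ≃L[ℝ] (ℝ × Ed d) :=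
  (LinearEquiv.prodCongr (LinearEquiv.smulOfNeZero ℝ ℝ (R ^ 2) (by positivity))
    (LinearEquiv.smulOfNeZero ℝ (Ed d) R hR.ne')).toContinuousLinearEquiv

theorem TL_apply {R : ℝ} (hR : 0 < R) (q : ℝ × Ed d) : TL d hR q = (R ^ 2 * q.1, R • q.2) := rfl

theorem TL_map {R : ℝ} (hR : 0 < R) : ∃ c : ℝ≥0∞, c ≠ 0 ∧ c ≠ ⊤ ∧
    Measure.map (TL d hR) (volume : Measure (ℝ × Ed d)) = c • volume := by
  have hdet : LinearMap.det ((TL d hR).toLinearEquiv : (ℝ × Ed d) →ₗ[ℝ] (ℝ × Ed d)) ≠ 0 :=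
    (LinearEquiv.isUnit_det' _).ne_zero
  refine ⟨_, ?_, ENNReal.ofReal_ne_top,
    Measure.map_linearMap_addHaar_eq_smul_addHaar (volume : Measure (ℝ × Ed d)) hdet⟩
  simpa [ENNReal.ofReal_eq_zero, not_le] using hdet

theorem TL_emb {R : ℝ} (hR : 0 < R) : MeasurableEmbedding (TL d hR) :=
  (TL d hR).toHomeomorph.measurableEmbedding

theorem TL_Qc {R : ℝ} (hR : 0 < R) (ρ : ℝ) :
    TL d hR ⁻¹' (Qc0 (R * ρ)) = Qc0 ρ := by
  rw [Qc0_eq, Qc0_eq]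
  ext ⟨t, x⟩
  have h2 : 0 < R ^ 2 := by positivity
  simp only [mem_preimage, TL_apply, Qm, mem_prod, mem_Ioo, mem_ball_zero_iff, norm_smul,
    Real.norm_eq_abs, abs_of_pos hR, neg_zero, mul_pow]
  refine and_congr (and_congr ?_ ?_) (mul_lt_mul_iff_right₀ hR)
  · rw [← mul_neg, mul_lt_mul_iff_right₀ h2]
  · rw [← mul_zero (R ^ 2), mul_lt_mul_iff_right₀ h2, mul_zero]

theorem TL_avg {E : Type*} [NormedAddCommGroup E] [NormedSpace ℝ E] {R : ℝ} (hR : 0 < R) (ρ : ℝ)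
    (f : ℝ × Ed d → E) :
    ⨍ q in Qc0 (d := d) ρ, f (TL d hR q) = ⨍ q in Qc0 (d := d) (R * ρ), f q := by
  obtain ⟨c, hc0, hc1, hc⟩ := TL_map (d := d) hR
  have e1 : ∫ q in Qc0 (d := d) ρ, f (TL d hR q) =
      c.toReal • ∫ q in Qc0 (d := d) (R * ρ), f q := by
    rw [← TL_Qc hR, ← (TL_emb hR).setIntegral_map, hc, Measure.restrict_smul,
      integral_smul_measure]
  have e2 : (volume : Measure (ℝ × Ed d)).real (Qc0 ρ) =
      c.toReal * (volume : Measure (ℝ × Ed d)).real (Qc0 (R * ρ)) := by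
    unfold Measure.real
    rw [← TL_Qc hR, ← (TL_emb hR).map_apply, hc, Measure.smul_apply, smul_eq_mul,
      ENNReal.toReal_mul]
  have hc2 : c.toReal ≠ 0 := (ENNReal.toReal_pos hc0 hc1).ne'
  rw [setAverage_eq, setAverage_eq, e1, e2, smul_smul, mul_inv, mul_right_comm,
    inv_mul_cancel₀ hc2, one_mul]

theorem TL_int {R : ℝ} (hR : 0 < R) {f : ℝ × Ed d → ℝ} (h : ∫ q, f q = 0) :
    ∫ q, f (TL d hR q) = 0 := by
  obtain ⟨c, hc0, hc1, hc⟩ := TL_map (d := d) hR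
  rw [← (TL_emb hR).integral_map, hc, integral_smul_measure, h, smul_zero]

theorem TL_dd {R : ℝ} (hR : 0 < R) (e : ℝ × Ed d) {u : ℝ × Ed d → Em m}
    (hu : ContDiff ℝ (⊤ : ℕ∞) u) (q : ℝ × Ed d) :
    dd e (fun q => u (TL d hR q)) q = dd (TL d hR e) u (TL d hR q) := by
  have h := ((hu.differentiable (by simp)) (TL d hR q)).hasFDerivAt.comp q
    (TL d hR).hasFDerivAt
  unfold dd
  rw [show (fun q => u (TL d hR q)) = u ∘ TL d hR from rfl, h.fderiv]
  rfl

theorem TL_pd {R : ℝ} (hR : 0 < R) (α : Fin d) {u : ℝ × Ed d → Em m}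
    (hu : ContDiff ℝ (⊤ : ℕ∞) u) (q : ℝ × Ed d) :
    pd α (fun q => u (TL d hR q)) q = R • pd α u (TL d hR q) := by
  rw [pd_eq_dd, TL_dd hR _ hu, TL_apply]
  unfold dd pd
  rw [← map_smul]
  congr 1
  simp

theorem TL_pt {R : ℝ} (hR : 0 < R) {u : ℝ × Ed d → Em m}
    (hu : ContDiff ℝ (⊤ : ℕ∞) u) (q : ℝ × Ed d) :
    pt (fun q => u (TL d hR q)) q = (R ^ 2) • pt u (TL d hR q) := by
  rw [pt_eq_dd, TL_dd hR _ hu, TL_apply]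
  unfold dd pt
  rw [← map_smul]
  congr 1
  simp

/-- rescaled coefficients -/
def TA (R : ℝ) (A : Fin d → Fin d → ℝ → CLM m) : Fin d → Fin d → ℝ → CLM m :=
  fun α β s => A α β (R * s)

theorem TA_coeffs (R : ℝ) (hA : CoeffsOne δ A) : CoeffsOne δ (TA R A) :=
  ⟨fun α β => (hA.1 α β).comp (measurable_const_mul R), fun s => hA.2 (R * s)⟩

theorem TL_Ubar {R : ℝ} (hR : 0 < R) {u : ℝ × Ed d → Em m}
    (hu : ContDiff ℝ (⊤ : ℕ∞) u) (q : ℝ × Ed d) :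
    Ubar (TA R A) (fun q => u (TL d hR q)) q = R • Ubar A u (TL d hR q) := by
  unfold Ubar
  rw [Finset.smul_sum]
  refine Finset.sum_congr rfl fun β _ => ?_
  rw [TL_pd hR β hu, map_smul]
  rfl

theorem TL_gradSq {R : ℝ} (hR : 0 < R) {u : ℝ × Ed d → Em m}
    (hu : ContDiff ℝ (⊤ : ℕ∞) u) (q : ℝ × Ed d) :
    gradSq (fun q => u (TL d hR q)) q = R ^ 2 * gradSq u (TL d hR q) := by
  unfold gradSq
  rw [Finset.mul_sum]
  refine Finset.sum_congr rfl fun β _ => ?_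
  rw [TL_pd hR β hu, norm_smul, mul_pow, Real.norm_eq_abs, sq_abs]

theorem TL_WS {R : ℝ} (hR : 0 < R) {u : ℝ × Ed d → Em m}
    (hu : ContDiff ℝ (⊤ : ℕ∞) u) (hw : WS A (Qc0 (R * 1)) u) :
    WS (TA R A) (Qc0 1) (fun q => u (TL d hR q)) := by
  intro φ hφ hc hs
  set ψ : ℝ × Ed d → Em m := fun q => φ ((TL d hR).symm q) with hψ
  have ψs : ContDiff ℝ (⊤ : ℕ∞) ψ := hφ.comp (TL d hR).symm.contDiff
  have ψc : HasCompactSupport ψ := hc.comp_homeomorph (TL d hR).symm.toHomeomorph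
  have ψt : tsupport ψ ⊆ Qc0 (R * 1) := by
    have : tsupport ψ = (TL d hR).symm ⁻¹' tsupport φ :=
      tsupport_comp_eq_preimage φ (TL d hR).symm.toHomeomorph
    rw [this]
    intro q hq
    have h1 := hs hq
    rw [← TL_Qc hR] at h1
    simpa using h1
  have e : φ = fun q => ψ (TL d hR q) := by
    funext q; simp [hψ]
  have h0 := TL_int hR (hw ψ ψs ψc ψt)
  have : ∀ q, ⟪pt (fun q => u (TL d hR q)) q, φ q⟫ +
      Bf (TA R A) (fun q => u (TL d hR q)) φ q =
      R ^ 2 * (⟪pt u (TL d hR q), ψ (TL d hR q)⟫ + Bf A u ψ (TL d hR q)) := by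
    intro q
    rw [e, TL_pt hR hu, real_inner_smul_left, mul_add]
    congr 1
    unfold Bf
    simp_rw [Finset.mul_sum]
    refine Finset.sum_congr rfl fun α _ => Finset.sum_congr rfl fun β _ => ?_
    rw [TL_pd hR β hu, TL_pd hR α ψs, map_smul, real_inner_smul_left, real_inner_smul_right,
      ← mul_assoc, ← sq]
    rfl
  simp_rw [this]
  rw [integral_const_mul, h0, mul_zero]

theorem TL_osc {R : ℝ} (hR : 0 < R) (ρ : ℝ) (F G : ℝ × Ed d → Em m)
    (h : ∀ q, G q = R • F (TL d hR q)) :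
    (⨍ q in Qc0 (d := d) ρ, ‖G q - (⨍ q' in Qc0 (d := d) ρ, G q')‖) =
      R * ⨍ q in Qc0 (d := d) (R * ρ), ‖F q - (⨍ q' in Qc0 (d := d) (R * ρ), F q')‖ := by
  have hG : G = fun q => R • F (TL d hR q) := funext h
  have e1 : (⨍ q' in Qc0 (d := d) ρ, G q') = R • ⨍ q' in Qc0 (d := d) (R * ρ), F q' := by
    rw [hG, TL_avg hR ρ (fun q => R • F q), average_eq, integral_smul, smul_comm, ← average_eq]
  rw [e1]
  have e2 : ∀ q, ‖G q - R • ⨍ q' in Qc0 (d := d) (R * ρ), F q'‖ =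
      R * ‖F (TL d hR q) - ⨍ q' in Qc0 (d := d) (R * ρ), F q'‖ := by
    intro q
    rw [h, ← smul_sub, norm_smul, Real.norm_eq_abs, abs_of_pos hR]
  simp_rw [e2]
  rw [TL_avg hR ρ (fun q => R * ‖F q - ⨍ q' in Qc0 (d := d) (R * ρ), F q'‖), average_eq,
    integral_const_mul, smul_eq_mul, mul_left_comm, ← smul_eq_mul (a := (_)⁻¹), ← average_eq]

end scaling

/-- Mean-oscillation estimates: for `κ ≥ 4` and smooth weak
solutions of the homogeneous system with coefficients depending only on `x₁` in
`Q_{κr}`, with `U = Σ_β Ā^{1β}(x₁) D_βu`,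
`(|U - (U)_{Q_r}|)_{Q_r} ≤ Nκ^{-1/2}((|Du|²)_{Q_{κr}})^{1/2}` and likewise for
`D_{x'}u`, with `N = N(d,m,δ)`. -/
theorem stmt_11
    (d m : ℕ) [NeZero d] [NeZero m] (δ : ℝ) (hδ : δ ∈ Set.Ioc (0:ℝ) 1) :
    ∃ N : ℝ, 0 < N ∧
    ∀ r κ : ℝ, 0 < r → 4 ≤ κ →
    ∀ (Ab : Fin d → Fin d → ℝ → CLM m), CoeffsOne δ Ab →
    ∀ u : ℝ × Ed d → Em m, ContDiff ℝ (⊤ : ℕ∞) u →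
    -- `-u_t + D_α(Ā^{αβ}(x₁)D_βu) = 0` weakly in `Q_{κr}`
    (∀ φt : ℝ × Ed d → Em m, ContDiff ℝ (⊤ : ℕ∞) φt → HasCompactSupport φt →
      tsupport φt ⊆ Qc0 (κ * r) →
      ∫ q, (⟪u q, pt φt q⟫ - ∑ α, ∑ β, ⟪Ab α β (q.2 0) (pd β u q), pd α φt q⟫) = 0) →
    ((⨍ q in Qc0 (d := d) r, ‖Ubar Ab u q - (⨍ q' in Qc0 (d := d) r, Ubar Ab u q')‖)
        ≤ N * κ ^ (-(1:ℝ)/2) * Real.sqrt (⨍ q in Qc0 (d := d) (κ * r), gradSq u q)) ∧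
    ∀ α : Fin d, α ≠ 0 →
      (⨍ q in Qc0 (d := d) r, ‖pd α u q - (⨍ q' in Qc0 (d := d) r, pd α u q')‖)
        ≤ N * κ ^ (-(1:ℝ)/2) * Real.sqrt (⨍ q in Qc0 (d := d) (κ * r), gradSq u q) := by
  obtain ⟨N, hN, h⟩ := unit_osc (d := d) (m := m) hδ.1 hδ.2
  refine ⟨N + 1, by linarith, ?_⟩
  intro r κ hr hκ Ab hA u hu hweak
  have hκ0 : 0 < κ := by linarith
  have hR : 0 < κ * r := by positivity
  have hws : WS Ab (Qc0 (κ * r * 1)) u := by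
    rw [mul_one]; exact WS_of_weak hδ.1 hA hu hweak
  have hRρ : κ * r * κ⁻¹ = r := by field_simp
  have hρ1 : κ⁻¹ ≤ 1 / 4 := by
    rw [one_div]; exact inv_anti₀ (by norm_num) hκ
  obtain ⟨h1, h2⟩ := h κ⁻¹ (by positivity) hρ1 (TA (κ * r) Ab) (fun q => u (TL d hR q))
    (TA_coeffs _ hA) (hu.comp (TL d hR).contDiff) (TL_WS hR hu hws)
  have hsq : √κ⁻¹ = κ ^ (-(1:ℝ)/2) := by
    rw [Real.sqrt_eq_rpow, Real.inv_rpow hκ0.le, ← Real.rpow_neg hκ0.le]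
    norm_num
  have hg : √(⨍ q in Qc0 (d := d) 1, gradSq (fun q => u (TL d hR q)) q) =
      (κ * r) * √(⨍ q in Qc0 (d := d) (κ * r), gradSq u q) := by
    simp_rw [TL_gradSq hR hu]
    rw [TL_avg hR 1 (fun q => (κ * r) ^ 2 * gradSq u q), mul_one, average_eq, integral_const_mul,
      smul_eq_mul, mul_left_comm, ← smul_eq_mul (a := (_)⁻¹), ← average_eq,
      Real.sqrt_mul (by positivity), Real.sqrt_sq hR.le]
  have fin : ∀ X : ℝ, (κ * r) * X ≤ N * κ ^ (-(1:ℝ)/2) *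
      ((κ * r) * √(⨍ q in Qc0 (d := d) (κ * r), gradSq u q)) →
      X ≤ (N + 1) * κ ^ (-(1:ℝ)/2) * √(⨍ q in Qc0 (d := d) (κ * r), gradSq u q) := by
    intro X hX
    rw [mul_left_comm] at hX
    have h3 := le_of_mul_le_mul_left hX hR
    refine h3.trans ?_
    have h4 : 0 ≤ κ ^ (-(1:ℝ)/2) * √(⨍ q in Qc0 (d := d) (κ * r), gradSq u q) := by positivity
    nlinarith
  rw [hsq, hg] at h1
  refine ⟨fin _ ?_, fun α hα => fin _ ?_⟩
  · rwa [TL_osc hR κ⁻¹ (Ubar Ab u) _ (TL_Ubar hR hu), hRρ] at h1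
  · have h5 := h2 α hα
    rw [hsq, hg] at h5
    rwa [TL_osc hR κ⁻¹ (pd α u) _ (TL_pd hR α hu), hRρ] at h5
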